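/- arXiv:math/9706213 — 2 statements merged into one kernel-verified Lean document; each statement's English description precedes it below -/
import Mathlib

section
/- The isometry group of ℓ∞(ℕ, B(H)) is topologically reflexive: if Φ : ℓ∞(ℕ, B(H)) → ℓ∞(ℕ, B(H)) is a bounded complex-linear map such that for every A ∈ ℓ∞(ℕ, B(H)) the element Φ(A) belongs to the norm-closure of the set { Ψ(A) : Ψ is a surjective linear isometry of ℓ∞(ℕ, B(H)) }, then Φ is itself a surjective linear isometry of ℓ∞(ℕ, B(H)). -/
open scoped ENNReal

/-- The algebra of bounded sequences of operators. -/
def LB (H : Type*) [NormedAddCommGroup H] [InnerProductSpace ℂ H] : Type _ :=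
  ↥(lp (fun _ : ℕ => H →L[ℂ] H) ∞)

set_option linter.unusedSectionVars false

section interface
variable {H : Type*} [NormedAddCommGroup H] [InnerProductSpace ℂ H] [CompleteSpace H] [Nontrivial H]

noncomputable instance LB.instNormedRing : NormedRing (LB H) :=
  inferInstanceAs (NormedRing ↥(lp (fun _ : ℕ => H →L[ℂ] H) ∞))

noncomputable instance LB.instStarRing : StarRing (LB H) :=
  (lp.inftyStarRing : StarRing ↥(lp (fun _ : ℕ => H →L[ℂ] H) ∞))

noncomputable instance LB.instNormedAlgebra : NormedAlgebra ℂ (LB H) :=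
  (lp.inftyNormedAlgebra : NormedAlgebra ℂ ↥(lp (fun _ : ℕ => H →L[ℂ] H) ∞))

noncomputable instance LB.cs : CStarAlgebra (LB H) where
  complete := (lp.completeSpace : CompleteSpace ↥(lp (fun _ : ℕ => H →L[ℂ] H) ∞)).complete
  norm_mul_self_le := (lp.inftyCStarRing : CStarRing ↥(lp (fun _ : ℕ => H →L[ℂ] H) ∞)).norm_mul_self_le
  star_smul := (inferInstance : StarModule ℂ ↥(lp (fun _ : ℕ => H →L[ℂ] H) ∞)).star_smul

/-- The coordinates. -/
def LB.ap (x : LB H) (n : ℕ) : H →L[ℂ] H := (show ↥(lp (fun _ : ℕ => H →L[ℂ] H) ∞) from x) n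

/-- Build from a bounded family. -/
def LB.mk (f : ℕ → H →L[ℂ] H) (C : ℝ) (hC : ∀ n, ‖f n‖ ≤ C) : LB H :=
  (⟨f, memℓp_infty ⟨C, by rintro _ ⟨n, rfl⟩; exact hC n⟩⟩ : ↥(lp (fun _ : ℕ => H →L[ℂ] H) ∞))

@[simp] lemma LB.mk_ap (f : ℕ → H →L[ℂ] H) (C : ℝ) (hC : ∀ n, ‖f n‖ ≤ C) (n : ℕ) :
  (LB.mk f C hC).ap n = f n := rfl

/-- A single operator in coordinate `m`. -/
noncomputable def LB.sg (m : ℕ) (a : H →L[ℂ] H) : LB H :=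
  LB.mk (fun n => if n = m then a else 0) ‖a‖ (fun n => by split_ifs <;> simp)

lemma LB.sg_ap (m : ℕ) (a : H →L[ℂ] H) (n : ℕ) : (LB.sg m a).ap n = if n = m then a else 0 := rfl
@[simp] lemma LB.sg_self (m : ℕ) (a : H →L[ℂ] H) : (LB.sg m a).ap m = a := by simp [LB.sg_ap]

lemma LB.norm_le (x : LB H) {C : ℝ} (hC : 0 ≤ C) (h : ∀ n v, ‖x.ap n v‖ ≤ C * ‖v‖) : ‖x‖ ≤ C :=
  lp.norm_le_of_forall_le hC fun n => ContinuousLinearMap.opNorm_le_bound _ hC (h n)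

lemma LB.ap_norm_le (x : LB H) (n : ℕ) : ‖x.ap n‖ ≤ ‖x‖ :=
    (lp.norm_apply_le_norm ENNReal.top_ne_zero (show ↥(lp (fun _ : ℕ => H →L[ℂ] H) ∞) from x) n)

lemma LB.le_norm (x : LB H) (n : ℕ) (v : H) : ‖x.ap n v‖ ≤ ‖x‖ * ‖v‖ :=
  (ContinuousLinearMap.le_opNorm _ _).trans (mul_le_mul_of_nonneg_right
    (x.ap_norm_le n) (norm_nonneg _))

lemma LB.ext {x y : LB H} (h : ∀ n, x.ap n = y.ap n) : x = y := by
  apply lp.ext; funext n; exact h n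

lemma LB.ext' {x y : LB H} (h : ∀ n v, x.ap n v = y.ap n v) : x = y := by
  apply LB.ext; intro n; ext v; exact h n v

@[simp] lemma LB.ap_mul (x y : LB H) (n : ℕ) : (x * y).ap n = x.ap n * y.ap n := rfl
@[simp] lemma LB.ap_one (n : ℕ) : (1 : LB H).ap n = 1 := rfl
@[simp] lemma LB.ap_add (x y : LB H) (n : ℕ) : (x + y).ap n = x.ap n + y.ap n := rfl
@[simp] lemma LB.ap_sub (x y : LB H) (n : ℕ) : (x - y).ap n = x.ap n - y.ap n := rfl
@[simp] lemma LB.ap_neg (x : LB H) (n : ℕ) : (-x).ap n = - x.ap n := rfl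
@[simp] lemma LB.ap_smul (c : ℂ) (x : LB H) (n : ℕ) : (c • x).ap n = c • x.ap n := rfl
@[simp] lemma LB.ap_zero (n : ℕ) : (0 : LB H).ap n = 0 := rfl
@[simp] lemma LB.ap_star (x : LB H) (n : ℕ) :
  (star x).ap n = ContinuousLinearMap.adjoint (x.ap n) := rfl

/-- coordinate map, continuous linear -/
noncomputable def LB.apL (n : ℕ) : LB H →L[ℂ] (H →L[ℂ] H) :=
  LinearMap.mkContinuous { toFun := fun x => x.ap n,
                           map_add' := fun _ _ => rfl,
                           map_smul' := fun _ _ => rfl } 1 (fun x => by rw [one_mul]; exact x.ap_norm_le n)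

@[simp] lemma LB.apL_apply (n : ℕ) (x : LB H) : LB.apL n x = x.ap n := rfl

/-- single operator embedding, continuous linear -/
noncomputable def LB.sgL (m : ℕ) : (H →L[ℂ] H) →L[ℂ] LB H :=
  LinearMap.mkContinuous { toFun := fun x => LB.sg m x,
                           map_add' := fun x y => by
                            apply LB.ext; intro n
                            by_cases h : n = m <;> simp [LB.sg_ap, h],
                           map_smul' := fun c y => by
                            apply LB.ext; intro n
                            by_cases h : n = m <;> simp [LB.sg_ap, h] } 1
    (fun x => by
      rw [one_mul]
      apply LB.norm_le _ (norm_nonneg _)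
      intro n v
      by_cases h : n = m
      · simpa [LB.sg_ap, h] using x.le_opNorm v
      · simp only [LinearMap.coe_mk, AddHom.coe_mk, LB.sg_ap, h, if_false]
        simp; positivity)

lemma LB.sgL_apply (m : ℕ) (x : H →L[ℂ] H) : LB.sgL m x = LB.sg m x := rfl
lemma LB.sg_add (m : ℕ) (x y : H →L[ℂ] H) : LB.sg m (x + y) = LB.sg m x + LB.sg m y :=
  (LB.sgL m).map_add x y
lemma LB.sg_sub (m : ℕ) (x y : H →L[ℂ] H) : LB.sg m (x - y) = LB.sg m x - LB.sg m y :=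
  (LB.sgL m).map_sub x y
lemma LB.sg_smul (m : ℕ) (c : ℂ) (x : H →L[ℂ] H) : LB.sg m (c • x) = c • LB.sg m x :=
  (LB.sgL m).map_smul c x
lemma LB.sg_zero (m : ℕ) : LB.sg m (0 : H →L[ℂ] H) = 0 := (LB.sgL m).map_zero
lemma LB.sg_mul (m : ℕ) (x y : H →L[ℂ] H) : LB.sg m x * LB.sg m y = LB.sg m (x * y) := by
  apply LB.ext; intro n
  by_cases h : n = m <;> simp [LB.sg_ap, h]
lemma LB.sg_mul_left (m : ℕ) (x : H →L[ℂ] H) (y : LB H) :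
    LB.sg m x * y = LB.sg m (x * y.ap m) := by
  apply LB.ext; intro n
  by_cases h : n = m
  · subst h; simp
  · simp [LB.sg_ap, h]
lemma LB.sg_mul_right (m : ℕ) (x : H →L[ℂ] H) (y : LB H) :
    y * LB.sg m x = LB.sg m (y.ap m * x) := by
  apply LB.ext; intro n
  by_cases h : n = m
  · subst h; simp
  · simp [LB.sg_ap, h]
lemma LB.sg_star (m : ℕ) (x : H →L[ℂ] H) :
    star (LB.sg m x) = LB.sg m (ContinuousLinearMap.adjoint x) := by
  apply LB.ext; intro n
  by_cases h : n = m <;> simp [LB.sg_ap, h]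

end interface
section jordan
variable {A : Type*} [CStarAlgebra A]

/-- Jordan star-homomorphism property. -/
structure IsJor (T : A →L[ℂ] A) : Prop where
  one : T 1 = 1
  star : ∀ a, T (star a) = star (T a)
  sq : ∀ a, T (a * a) = T a * T a

lemma jor_selfAdjoint (T : A →L[ℂ] A) (h1 : T 1 = 1)
    (hu : ∀ u ∈ unitary A, T u ∈ unitary A) (a : A) (ha : IsSelfAdjoint a) :
    star (T a) = T a ∧ star (T (a * a)) + T (a * a) = (2 : ℂ) • (T a * T a) := by
  set x : A := Complex.I • a with hx
  have hexp : ∀ t : ℝ, NormedSpace.exp (t • x) ∈ unitary A := by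
    intro t
    have hta : IsSelfAdjoint (t • a) := by
      rw [IsSelfAdjoint, star_smul, ha.star_eq]; simp
    have := (selfAdjoint.expUnitary ⟨t • a, hta⟩).2
    rw [selfAdjoint.expUnitary_coe] at this
    rw [hx, smul_comm]
    exact this
  have h0 : ∀ y : A, ∀ t : ℝ, HasDerivAt (fun t : ℝ => T (NormedSpace.exp (t • x) * y))
      (T (NormedSpace.exp (t • x) * x * y)) t := by
    intro y t
    have h := (hasDerivAt_exp_smul_const (𝕂 := ℝ) x t).mul_const y
    have := (T.restrictScalars ℝ).hasFDerivAt.comp_hasDerivAt t h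
    exact this
  have hF0 := h0 1
  have hF1 := h0 x
  simp only [mul_one] at hF0
  have e0 : ∀ t : ℝ, star (T (NormedSpace.exp (t • x))) * T (NormedSpace.exp (t • x)) = 1 :=
    fun t => (Unitary.mem_iff.1 (hu _ (hexp t))).1
  have e1 : ∀ t : ℝ, star (T (NormedSpace.exp (t • x) * x)) * T (NormedSpace.exp (t • x))
      + star (T (NormedSpace.exp (t • x))) * T (NormedSpace.exp (t • x) * x) = 0 := by
    intro t
    have h := (hF0 t).star.mul (hF0 t)
    have h' : HasDerivAt (fun t : ℝ => star (T (NormedSpace.exp (t • x)))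
      * T (NormedSpace.exp (t • x))) 0 t := by
      simp only [e0]; exact hasDerivAt_const t (1 : A)
    exact h.unique h'
  have e2 := by
    have h := ((hF1 0).star.mul (hF0 0)).add ((hF0 0).star.mul (hF1 0))
    have h' : HasDerivAt (fun t : ℝ => star (T (NormedSpace.exp (t • x) * x))
      * T (NormedSpace.exp (t • x))
      + star (T (NormedSpace.exp (t • x))) * T (NormedSpace.exp (t • x) * x)) 0 0 := by
      simp only [e1]; exact hasDerivAt_const 0 (0 : A)
    exact h.unique h'
  have e1' := e1 0
  simp only [zero_smul, NormedSpace.exp_zero, one_mul, h1, star_one, mul_one] at e1' e2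
  have k1 : star (T a) = T a := by
    rw [hx] at e1'
    simp only [map_smul, star_smul, Complex.star_def, Complex.conj_I, neg_smul] at e1'
    have : Complex.I • (T a - star (T a)) = 0 := by rw [smul_sub]; rw [← e1']; abel
    rw [smul_eq_zero] at this
    rcases this with h | h
    · exact absurd h Complex.I_ne_zero
    · exact (sub_eq_zero.1 h).symm
  refine ⟨k1, ?_⟩
  have : x * x = - (a * a) := by
    rw [hx]; simp [smul_smul]
  rw [this] at e2
  have hTx : T x = Complex.I • T a := by rw [hx, map_smul]
  rw [hTx] at e2
  simp only [map_neg, star_neg, star_smul, k1, Complex.star_def, Complex.conj_I, neg_smul,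
    neg_mul, smul_mul_assoc, mul_smul_comm, smul_neg, smul_smul, Complex.I_mul_I, one_smul,
    neg_neg] at e2
  rw [two_smul]
  have e3 := congrArg (fun z => z + (star (T (a * a)) + T (a * a))) e2
  simp only [zero_add] at e3
  rw [← e3]; abel

lemma isJor_of_unitary (T : A →L[ℂ] A) (h1 : T 1 = 1)
    (hu : ∀ u ∈ unitary A, T u ∈ unitary A) : IsJor T := by
  have hsa : ∀ a : A, IsSelfAdjoint a → star (T a) = T a := fun a ha =>
    (jor_selfAdjoint T h1 hu a ha).1
  have hsq : ∀ a : A, IsSelfAdjoint a → T (a * a) = T a * T a := by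
    intro a ha
    have h := (jor_selfAdjoint T h1 hu a ha).2
    rw [hsa (a * a) (by rw [IsSelfAdjoint, star_mul, ha.star_eq]), ← two_smul ℂ] at h
    exact smul_right_injective A (two_ne_zero) h
  have hdec : ∀ a : A, ∃ b c : A, IsSelfAdjoint b ∧ IsSelfAdjoint c ∧ a = b + Complex.I • c :=
    fun a => ⟨realPart a, imaginaryPart a, (realPart a).2, (imaginaryPart a).2,
      (realPart_add_I_smul_imaginaryPart a).symm⟩
  refine ⟨h1, ?_, ?_⟩
  · intro a
    obtain ⟨b, c, hb, hc, rfl⟩ := hdec a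
    simp only [star_add, star_smul, map_add, map_smul, hb.star_eq, hc.star_eq, hsa b hb, hsa c hc]
  · intro a
    obtain ⟨b, c, hb, hc, rfl⟩ := hdec a
    have h := hsq (b + c) (hb.add hc)
    have hbc : T (b * c) + T (c * b) = T b * T c + T c * T b := by
      simp only [mul_add, add_mul, map_add, hsq b hb, hsq c hc] at h
      have := congrArg (fun z => z - T b * T b - T c * T c) h
      calc _ = T b * T b + T (c * b) + (T (b * c) + T c * T c) - T b * T b - T c * T c := by abel
        _ = _ := by rw [this]; abel
    have hc' := congrArg (fun z => Complex.I • z) hbc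
    simp only [smul_add] at hc'
    simp only [mul_add, add_mul, map_add, map_smul, smul_mul_assoc, mul_smul_comm, smul_add, smul_smul,
      hsq b hb, hsq c hc]
    have := congrArg (fun z => z + T b * T b + (Complex.I * Complex.I) • (T c * T c)) hc'
    calc _ = Complex.I • T (b * c) + Complex.I • T (c * b) + T b * T b
          + (Complex.I * Complex.I) • (T c * T c) := by abel
      _ = _ := by rw [this]; abel

namespace IsJor
variable {T : A →L[ℂ] A}

lemma jmul (hT : IsJor T) (a b : A) : T (a * b + b * a) = T a * T b + T b * T a := by
  have h := hT.sq (a + b)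
  have e : a * b + b * a = (a + b) * (a + b) - a * a - b * b := by noncomm_ring
  rw [e, map_sub, map_sub, h, hT.sq, hT.sq, map_add]
  noncomm_ring

lemma triple (hT : IsJor T) (a b : A) : T (a * b * a) = T a * T b * T a := by
  have e : (2 : ℂ) • (a * b * a) = (a * (a * b + b * a) + (a * b + b * a) * a)
      - ((a * a) * b + b * (a * a)) := by rw [two_smul]; noncomm_ring
  have h := congrArg T e
  rw [map_smul, map_sub, hT.jmul, hT.jmul, hT.jmul, hT.sq] at h
  apply smul_right_injective A (two_ne_zero (α := ℂ))
  simp only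
  rw [h, two_smul]; noncomm_ring

lemma triple' (hT : IsJor T) (a b c : A) : T (a * b * c + c * b * a) = T a * T b * T c + T c * T b * T a := by
  have e : a * b * c + c * b * a = (a + c) * b * (a + c) - a * b * a - c * b * c := by
    noncomm_ring
  rw [e, map_sub, map_sub, hT.triple, hT.triple, hT.triple, map_add]
  noncomm_ring

end IsJor
end jordan

section unitaries
variable {H : Type*} [NormedAddCommGroup H] [InnerProductSpace ℂ H] [CompleteSpace H] [Nontrivial H]

/-- Geometric vertex property. -/
def Vtx (u : LB H) : Prop :=
  ‖u‖ ≤ 1 ∧ ∀ x : LB H, (∃ C : ℝ, ∀ t : ℂ, ‖u + t • x‖ ^ 2 ≤ 1 + C * ‖t‖ ^ 2) → x = 0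

instance : Nontrivial (LB H) := ⟨⟨0, 1, fun h => by
  obtain ⟨v, hv⟩ := exists_ne (0 : H)
  have := congrArg (fun x => LB.ap x 0 v) h
  exact hv (by simpa using this.symm)⟩⟩

lemma vtx_one : Vtx (1 : LB H) := by
  refine ⟨norm_one.le, ?_⟩
  rintro x ⟨C, hC⟩
  apply LB.ext'
  intro n v
  have key : x.ap n = 0 := by
    rw [← ContinuousLinearMap.coe_inj]
    refine (inner_map_self_eq_zero _).1 ?_
    have main : ∀ v : H, ‖v‖ = 1 → inner ℂ (x.ap n v) v = 0 := by
      intro v hv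
      set w : ℂ := inner ℂ v (x.ap n v) with hw
      have hw0 : w = 0 := by
        by_contra hne
        have hpos : 0 < ‖w‖ := norm_pos_iff.2 hne
        have hineq : ∀ s : ℝ, 0 < s → 2 * s * ‖w‖ ^ 2 ≤ C * s ^ 2 * ‖w‖ ^ 2 := by
          intro s hs
          have h1 := hC (s * (starRingEnd ℂ) w)
          have h2 : ‖(1 : ℂ) + (s * (starRingEnd ℂ) w) * w‖ ≤
              ‖(1 : LB H) + (s * (starRingEnd ℂ) w) • x‖ := by
            have h3 := LB.le_norm ((1 : LB H) + (s * (starRingEnd ℂ) w) • x) n v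
            have h4 := norm_inner_le_norm (𝕜 := ℂ) v
              (((1 : LB H) + (s * (starRingEnd ℂ) w) • x).ap n v)
            simp only [hv, mul_one, one_mul] at h3 h4
            refine le_trans (le_of_eq ?_) (h4.trans h3)
            simp only [LB.ap_add, LB.ap_smul, LB.ap_one, ContinuousLinearMap.add_apply,
              ContinuousLinearMap.smul_apply, ContinuousLinearMap.one_apply, inner_add_right, inner_smul_right,
              inner_self_eq_norm_sq_to_K, hv]
            simp [← hw]
          have h5 : (1 : ℂ) + (s * (starRingEnd ℂ) w) * w = ((1 + s * ‖w‖ ^ 2 : ℝ) : ℂ) := by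
            rw [mul_assoc, Complex.conj_mul']; push_cast; ring
          rw [h5, Complex.norm_real, Real.norm_of_nonneg (by positivity)] at h2
          have h6 : (1 + s * ‖w‖ ^ 2) ^ 2 ≤ 1 + C * (s * ‖w‖) ^ 2 := by
            refine (pow_le_pow_left₀ (by positivity) h2 2).trans (h1.trans (le_of_eq ?_))
            simp [abs_of_pos hs]
          nlinarith [sq_nonneg (s * ‖w‖ ^ 2)]
        have h7 := hineq (1 / (|C| + 1)) (by positivity)
        have h8 : 0 < ‖w‖ ^ 2 := by positivity
        have h9 : 2 * (1 / (|C| + 1)) ≤ C * (1 / (|C| + 1)) ^ 2 := le_of_mul_le_mul_right h7 h8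
        have h10 : 0 < |C| + 1 := by positivity
        have h11 : C * (1 / (|C| + 1)) ^ 2 ≤ 1 * (1 / (|C| + 1)) := by
          rw [sq, ← mul_assoc]
          apply mul_le_mul_of_nonneg_right _ (by positivity)
          rw [mul_one_div, div_le_one h10]
          linarith [le_abs_self C]
        have h12 : 0 < 1 / (|C| + 1) := by positivity
        linarith
      rw [← inner_conj_symm, ← hw, hw0, map_zero]
    intro v
    by_cases hv : v = 0
    · simp [hv]
    · have h := main ((‖v‖⁻¹ : ℂ) • v) (by
        rw [norm_smul]; simp [hv])
      simp only [map_smul, inner_smul_left, inner_smul_right] at h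
      simpa [hv] using h
  rw [key]; rfl

lemma vtx_of_unitary {u : LB H} (hu : u ∈ unitary (LB H)) : Vtx u := by
  refine ⟨(CStarRing.norm_of_mem_unitary hu).le, ?_⟩
  rintro x ⟨C, hC⟩
  have h := vtx_one.2 (star u * x) ⟨C, fun t => ?_⟩
  · calc x = u * (star u * x) := by
          rw [← mul_assoc, (Unitary.mem_iff.1 hu).2, one_mul]
      _ = 0 := by rw [h, mul_zero]
  · have : (1 : LB H) + t • (star u * x) = star u * (u + t • x) := by
      rw [mul_add, (Unitary.mem_iff.1 hu).1, mul_smul_comm]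
    rw [this, CStarRing.norm_mem_unitary_mul _ (Unitary.star_mem hu)]
    exact hC t

lemma vtx_coisom {u : LB H} (hu : Vtx u) : u * star u = 1 := by
  obtain ⟨hu1, hu2⟩ := hu
  set h : LB H := 1 - u * star u with hh
  have hstar : star h = h := by rw [hh, star_sub, star_one, star_mul, star_star]
  have h0 : h = 0 := by
    apply hu2
    refine ⟨1, fun t => ?_⟩
    have hb : ‖star (u + t • h)‖ ≤ √(1 + ‖t‖ ^ 2) := by
      apply LB.norm_le _ (Real.sqrt_nonneg _)
      intro n v
      have e1 : ‖(star u).ap n v‖ ^ 2 + ‖h.ap n v‖ ^ 2 ≤ ‖v‖ ^ 2 := by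
        have a1 : h.ap n v = v - u.ap n ((star u).ap n v) := rfl
        have a2 : ‖h.ap n v‖ ^ 2 = ‖v‖ ^ 2 - 2 * ‖(star u).ap n v‖ ^ 2
            + ‖u.ap n ((star u).ap n v)‖ ^ 2 := by
          rw [a1, @norm_sub_sq ℂ, ← ContinuousLinearMap.adjoint_inner_left, ← LB.ap_star, inner_self_eq_norm_sq]
        have a3 : ‖u.ap n ((star u).ap n v)‖ ≤ ‖(star u).ap n v‖ :=
          (LB.le_norm _ _ _).trans (mul_le_of_le_one_left (norm_nonneg _) hu1)
        have a4 := pow_le_pow_left₀ (norm_nonneg _) a3 2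
        linarith
      have e2 : ‖(star (u + t • h)).ap n v‖ ≤ ‖(star u).ap n v‖ + ‖t‖ * ‖h.ap n v‖ := by
        rw [star_add, star_smul, hstar]
        refine (norm_add_le _ _).trans ?_
        exact le_of_eq (congrArg _ ((norm_smul (star t) (h.ap n v)).trans (by rw [norm_star])))
      refine e2.trans ?_
      apply le_of_sq_le_sq _ (by positivity)
      rw [mul_pow, Real.sq_sqrt (by positivity)]
      have := sq_nonneg (‖t‖ * ‖(star u).ap n v‖ - ‖h.ap n v‖)
      nlinarith [mul_le_mul_of_nonneg_left e1 (sq_nonneg ‖t‖)]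
    rw [norm_star] at hb
    calc _ ≤ √(1 + ‖t‖ ^ 2) ^ 2 := pow_le_pow_left₀ (norm_nonneg _) hb 2
      _ = _ := by rw [Real.sq_sqrt (by positivity)]; ring
  rw [hh, sub_eq_zero] at h0
  exact h0.symm

lemma vtx_star {u : LB H} (hu : Vtx u) : Vtx (star u) := by
  refine ⟨by rw [norm_star]; exact hu.1, ?_⟩
  rintro x ⟨C, hC⟩
  have h := hu.2 (star x) ⟨C, fun t => ?_⟩
  · exact star_eq_zero.1 h
  · have := hC (star t)
    rw [← norm_star, star_add, star_smul, star_star, star_star, norm_star] at this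
    exact this

lemma unitary_of_vtx {u : LB H} (hu : Vtx u) : u ∈ unitary (LB H) := by
  rw [Unitary.mem_iff]
  refine ⟨?_, vtx_coisom hu⟩
  simpa using vtx_coisom (vtx_star hu)

/-- Surjective linear isometries preserve unitaries. -/
lemma surj_isom_unitary (Ψ : LB H →ₗ[ℂ] LB H) (hs : Function.Surjective Ψ)
    (hi : ∀ a, ‖Ψ a‖ = ‖a‖) {u : LB H} (hu : u ∈ unitary (LB H)) : Ψ u ∈ unitary (LB H) := by
  apply unitary_of_vtx
  have hv := vtx_of_unitary hu
  refine ⟨by rw [hi]; exact hv.1, ?_⟩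
  rintro x ⟨C, hC⟩
  obtain ⟨y, rfl⟩ := hs x
  rw [hv.2 y ⟨C, fun t => ?_⟩, map_zero]
  have := hC t
  rwa [← map_smul, ← map_add, hi] at this

/-- A surjective linear isometry maps central projections to elements with central `star x * x`. -/
lemma surj_isom_central (Ψ : LB H →ₗ[ℂ] LB H) (hs : Function.Surjective Ψ)
    (hi : ∀ a, ‖Ψ a‖ = ‖a‖) {z : LB H} (hz : ∀ a, z * a = a * z) (hz1 : star z = z)
    (hz2 : z * z = z) (c : LB H) : (star (Ψ z) * Ψ z) * c = c * (star (Ψ z) * Ψ z) := by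
  set w := Ψ 1 with hw
  have hwu : w ∈ unitary (LB H) := surj_isom_unitary Ψ hs hi (one_mem _)
  let Ψc : LB H →L[ℂ] LB H := Ψ.mkContinuous 1 (fun a => by rw [hi, one_mul])
  let T : LB H →L[ℂ] LB H := (ContinuousLinearMap.mul ℂ (LB H) (star w)).comp Ψc
  have hTa : ∀ a, T a = star w * Ψ a := fun a => rfl
  have hT : IsJor T := by
    apply isJor_of_unitary
    · rw [hTa, ← hw]; exact (Unitary.mem_iff.1 hwu).1
    · intro u hu
      rw [hTa]
      exact mul_mem (Unitary.star_mem hwu) (surj_isom_unitary Ψ hs hi hu)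
  have hTs : Function.Surjective T := by
    intro b
    obtain ⟨a, ha⟩ := hs (w * b)
    refine ⟨a, ?_⟩
    rw [hTa, ha, ← mul_assoc, (Unitary.mem_iff.1 hwu).1, one_mul]
  have e : star (Ψ z) * Ψ z = T z := by
    have : Ψ z = w * T z := by rw [hTa, ← mul_assoc, (Unitary.mem_iff.1 hwu).2, one_mul]
    rw [this, star_mul, ← hT.star, hz1, mul_assoc, ← mul_assoc (star w),
      (Unitary.mem_iff.1 hwu).1, one_mul, ← hT.sq, hz2]
  rw [e]
  obtain ⟨a, rfl⟩ := hTs c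
  have hq : T z * T z = T z := by rw [← hT.sq, hz2]
  have h1 : T z * T a + T a * T z = (2 : ℂ) • (T z * T a * T z) := by
    rw [← hT.jmul, ← hT.triple, ← map_smul]
    congr 1
    rw [two_smul, hz a, mul_assoc, hz2]
  have h2 : T z * T a = T z * T a * T z := by
    have := congrArg (fun y => T z * y) h1
    simp only [mul_add, ← mul_assoc, hq, two_smul] at this
    exact add_right_cancel this
  have h3 : T a * T z = T z * T a * T z := by
    have := congrArg (fun y => y * T z) h1
    simp only [add_mul, mul_assoc, hq, two_smul] at this
    simp only [mul_assoc]
    exact add_left_cancel this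
  rw [h2, ← h3]

end unitaries

section smooth
variable {H : Type*} [NormedAddCommGroup H] [InnerProductSpace ℂ H] [CompleteSpace H] [Nontrivial H]
open InnerProductSpace

/-- Quantitative smoothness of the norm. -/
def Sm (x : LB H) : Prop :=
  ∀ y : LB H, ‖y‖ ≤ 1 → ‖x + (1 / 2 : ℂ) • y‖ ^ 2 + ‖x - (1 / 2 : ℂ) • y‖ ^ 2 ≤ 7 / 2

lemma pyth {ξ : H} (hξ : ‖ξ‖ = 1) (z : H) :
    ‖z - inner ℂ ξ z • ξ‖ ^ 2 = ‖z‖ ^ 2 - ‖inner ℂ ξ z‖ ^ 2 := by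
  rw [@norm_sub_sq ℂ, inner_smul_right, norm_smul, hξ, mul_one]
  have : inner ℂ ξ z * inner ℂ z ξ = ((‖inner ℂ ξ z‖ ^ 2 : ℝ) : ℂ) := by
    rw [← inner_conj_symm z ξ, Complex.mul_conj']; push_cast; rfl
  rw [this]
  simp only [Complex.coe_algebraMap, RCLike.re_to_complex, Complex.ofReal_re]
  ring

lemma sm_bound (m : ℕ) {ξ : H} (hξ : ‖ξ‖ = 1) (y : LB H) (hy : ‖y‖ ≤ 1) :
    ‖LB.sg m (rankOne ℂ ξ ξ) + (1 / 2 : ℂ) • y‖ ^ 2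
      ≤ ‖1 + (1 / 2 : ℂ) * inner ℂ ξ (y.ap m ξ)‖ ^ 2 + 1 / 2 := by
  set w : ℂ := inner ℂ ξ (y.ap m ξ) with hw
  set k : ℝ := ‖1 + (1 / 2 : ℂ) * w‖ with hk
  have hk0 : 0 ≤ k := norm_nonneg _
  have hyv : ∀ n v, ‖y.ap n v‖ ≤ ‖v‖ := fun n v =>
    (LB.le_norm y n v).trans (mul_le_of_le_one_left (norm_nonneg _) hy)
  have hb : ‖LB.sg m (rankOne ℂ ξ ξ) + (1 / 2 : ℂ) • y‖ ≤ √(k ^ 2 + 1 / 2) := by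
    apply LB.norm_le _ (Real.sqrt_nonneg _)
    intro n v
    apply le_of_sq_le_sq _ (by positivity)
    rw [mul_pow, Real.sq_sqrt (by positivity)]
    by_cases h : n = m
    · subst h
      set z : H := inner ℂ ξ v • ξ + (1 / 2 : ℂ) • y.ap n v with hz
      have e0 : (LB.sg n (rankOne ℂ ξ ξ) + (1 / 2 : ℂ) • y).ap n v = z := by
        simp [hz]
      rw [e0]
      set a : ℂ := inner ℂ ξ v with ha
      set v' : H := v - a • ξ with hv'
      have hv'n : ‖v'‖ ^ 2 = ‖v‖ ^ 2 - ‖a‖ ^ 2 := pyth hξ v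
      have hzn := pyth hξ z
      have hξξ : inner ℂ ξ ξ = (1 : ℂ) := by rw [inner_self_eq_norm_sq_to_K, hξ]; simp
      have e1 : inner ℂ ξ z = a + (1 / 2 : ℂ) * inner ℂ ξ (y.ap n v) := by
        rw [hz, inner_add_right, inner_smul_right, inner_smul_right, hξξ, mul_one]
      have e2 : inner ℂ ξ z = a * (1 + (1 / 2 : ℂ) * w) + (1 / 2 : ℂ) * inner ℂ ξ (y.ap n v') := by
        rw [e1, hv', map_sub, map_smul, inner_sub_right, inner_smul_right, ← hw]; ring
      have e3 : ‖inner ℂ ξ z‖ ≤ ‖a‖ * k + 1 / 2 * ‖v'‖ := by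
        rw [e2]
        refine (norm_add_le _ _).trans ?_
        rw [norm_mul, norm_mul, ← hk]
        have h1 := norm_inner_le_norm (𝕜 := ℂ) ξ (y.ap n v')
        rw [hξ, one_mul] at h1
        have h2 := h1.trans (hyv n v')
        have h3 : ‖(1 / 2 : ℂ)‖ = 1 / 2 := by simp
        rw [h3]
        linarith
      have e4 : z - inner ℂ ξ z • ξ = (1 / 2 : ℂ) • (y.ap n v - inner ℂ ξ (y.ap n v) • ξ) := by
        rw [e1, hz, add_smul, smul_sub, mul_smul]; abel
      have e5 : ‖z - inner ℂ ξ z • ξ‖ ^ 2 ≤ 1 / 4 * ‖v‖ ^ 2 := by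
        rw [e4, norm_smul, mul_pow, pyth hξ]
        have h3 : ‖(1 / 2 : ℂ)‖ ^ 2 = 1 / 4 := by norm_num
        rw [h3]
        have h4 := pow_le_pow_left₀ (norm_nonneg _) (hyv n v) 2
        have h5 := sq_nonneg ‖inner ℂ ξ (y.ap n v)‖
        linarith
      have e6 := pow_le_pow_left₀ (norm_nonneg _) e3 2
      have e7 := sq_nonneg (k * ‖v'‖ - 1 / 2 * ‖a‖)
      nlinarith
    · have e0 : (LB.sg m (rankOne ℂ ξ ξ) + (1 / 2 : ℂ) • y).ap n v = (1 / 2 : ℂ) • y.ap n v := by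
        simp [LB.sg_ap, h]
      rw [e0, norm_smul, mul_pow]
      have h3 : ‖(1 / 2 : ℂ)‖ ^ 2 = 1 / 4 := by norm_num
      rw [h3]
      have h4 := pow_le_pow_left₀ (norm_nonneg _) (hyv n v) 2
      nlinarith [sq_nonneg (k * ‖v‖), sq_nonneg ‖v‖]
  calc _ ≤ √(k ^ 2 + 1 / 2) ^ 2 := pow_le_pow_left₀ (norm_nonneg _) hb 2
    _ = _ := Real.sq_sqrt (by positivity)

lemma sm_min (m : ℕ) {ξ : H} (hξ : ‖ξ‖ = 1) : Sm (LB.sg m (rankOne ℂ ξ ξ)) := by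
  intro y hy
  have h1 := sm_bound m hξ y hy
  have h2 := sm_bound m hξ (-y) (by rwa [norm_neg])
  rw [smul_neg, ← sub_eq_add_neg] at h2
  simp only [LB.ap_neg, ContinuousLinearMap.neg_apply, inner_neg_right, mul_neg] at h2
  set w : ℂ := inner ℂ ξ (y.ap m ξ) with hw
  have hwn : ‖w‖ ≤ 1 := by
    have h3 := norm_inner_le_norm (𝕜 := ℂ) ξ (y.ap m ξ)
    have h4 := LB.le_norm y m ξ
    rw [hξ] at h3 h4
    rw [hw]; linarith
  have h5 := parallelogram_law_with_norm ℝ (1 : ℂ) (1 / 2 * w)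
  have h6 : ‖(1 / 2 * w : ℂ)‖ = 1 / 2 * ‖w‖ := by simp
  rw [← sub_eq_add_neg] at h2
  rw [h6, norm_one] at h5
  nlinarith [norm_nonneg w]

lemma proj_norm_ne {d : LB H} (h0 : d ≠ 0) (h1 : d * d = d) (h2 : star d = d) : ‖d‖ = 1 := by
  have h := CStarRing.norm_star_mul_self (x := d)
  rw [h2, h1] at h
  have hp : ‖d‖ ≠ 0 := norm_ne_zero_iff.2 h0
  exact (mul_left_cancel₀ hp (by rw [← h, mul_one])).symm

lemma proj_norm {d : LB H} (h1 : d * d = d) (h2 : star d = d) : ‖d‖ ≤ 1 := by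
  by_cases h : d = 0
  · simp [h]
  · exact (proj_norm_ne h h1 h2).le

lemma adj_rankOne (x y : H) :
    ContinuousLinearMap.adjoint (rankOne ℂ x y) = rankOne ℂ y x := by
  ext v
  apply ext_inner_left ℂ
  intro w
  rw [ContinuousLinearMap.adjoint_inner_right]
  simp [inner_smul_left, inner_smul_right, mul_comm]

lemma min_of_sm {q : LB H} (h0 : q ≠ 0) (h1 : q * q = q) (h2 : star q = q) (hs : Sm q) :
    ∃ (n : ℕ) (f : H), ‖f‖ = 1 ∧ q = LB.sg n (rankOne ℂ f f) := by
  have : ∃ n v, q.ap n v ≠ 0 := by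
    by_contra hcon
    push Not at hcon
    exact h0 (LB.ext' fun n v => by simpa using hcon n v)
  obtain ⟨n, v, hv⟩ := this
  set f : H := (‖q.ap n v‖⁻¹ : ℂ) • q.ap n v with hf
  have hf1 : ‖f‖ = 1 := by rw [hf, norm_smul]; simp [hv]
  have hqq : q.ap n * q.ap n = q.ap n := by rw [← LB.ap_mul, h1]
  have hqf : q.ap n f = f := by
    rw [hf, map_smul]
    congr 1
    exact congrArg (fun T : H →L[ℂ] H => T v) hqq
  refine ⟨n, f, hf1, ?_⟩
  set e : LB H := LB.sg n (rankOne ℂ f f) with he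
  have hee : e * e = e := by
    rw [he, LB.sg_mul]; congr 1; exact isIdempotentElem_rankOne_self hf1
  have hes : star e = e := by rw [he, LB.sg_star, adj_rankOne]
  have hqe : q * e = e := by
    rw [he, LB.sg_mul_right]; congr 1
    ext w; simp [hqf]
  have heq : e * q = e := by
    have := congrArg star hqe
    rwa [star_mul, h2, hes] at this
  have hene : e ≠ 0 := by
    intro h
    have := congrArg (fun x : LB H => x.ap n f) h
    simp [he, hf1] at this
    rw [this] at hf1; simp at hf1
  by_contra hne
  obtain ⟨d, hd⟩ : ∃ d : LB H, d = q - e := ⟨_, rfl⟩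
  have hd0 : d ≠ 0 := hd ▸ sub_ne_zero.2 hne
  have hdd : d * d = d := by
    rw [hd, mul_sub, sub_mul, sub_mul, h1, hqe, heq, hee]; abel
  have hds : star d = d := by rw [hd, star_sub, h2, hes]
  have hed : e * d = 0 := by rw [hd, mul_sub, heq, hee, sub_self]
  have hde : d * e = 0 := by rw [hd, sub_mul, hqe, hee, sub_self]
  have hq : q = e + d := by rw [hd]; abel
  have hy : ‖e - d‖ ≤ 1 := by
    have h := CStarRing.norm_star_mul_self (x := e - d)
    have e1 : star (e - d) * (e - d) = q := by
      rw [star_sub, hes, hds, mul_sub, sub_mul, sub_mul, hee, hdd, hed, hde, hq]; abel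
    rw [e1, proj_norm_ne h0 h1 h2] at h
    nlinarith [norm_nonneg (e - d)]
  have hmain := hs (e - d) hy
  have key : ∀ x p : LB H, p ≠ 0 → p * p = p → star p = p → x * p = (3 / 2 : ℂ) • p →
      (3 / 2 : ℝ) ≤ ‖x‖ := by
    intro x p hp0 hpp hps hxp
    have h := norm_mul_le x p
    rw [hxp, norm_smul, proj_norm_ne hp0 hpp hps] at h
    simpa using h
  have k1 := key (q + (1 / 2 : ℂ) • (e - d)) e hene hee hes (by
    rw [add_mul, smul_mul_assoc, sub_mul, hqe, hee, hde, sub_zero]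
    module)
  have k2 := key (q - (1 / 2 : ℂ) • (e - d)) d hd0 hdd hds (by
    rw [sub_mul, smul_mul_assoc, sub_mul, hed, hdd, hq, add_mul, hed, hdd]
    module)
  nlinarith

lemma sm_isom (Ψ : LB H →ₗ[ℂ] LB H) (hs : Function.Surjective Ψ)
    (hi : ∀ a, ‖Ψ a‖ = ‖a‖) {x : LB H} (hx : Sm x) : Sm (Ψ x) := by
  intro y hy
  obtain ⟨y, rfl⟩ := hs y
  rw [hi] at hy
  rw [← map_smul, ← map_add, ← map_sub, hi, hi]
  exact hx y hy

lemma sm_closed : IsClosed {x : LB H | Sm x} := by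
  simp only [Sm, Set.setOf_forall]
  refine isClosed_iInter fun y => isClosed_iInter fun hy => ?_
  exact isClosed_le (by fun_prop) continuous_const

end smooth

section peirce
variable {H : Type*} [NormedAddCommGroup H] [InnerProductSpace ℂ H] [CompleteSpace H] [Nontrivial H]
open InnerProductSpace

/-- The properties of the normalised map that are used in the sequel. -/
structure Good (T : LB H →L[ℂ] LB H) : Prop where
  jor : IsJor T
  iso : ∀ a, ‖T a‖ = ‖a‖
  cent : ∀ z : LB H, (∀ a, z * a = a * z) → star z = z → z * z = z → ∀ c, T z * c = c * T z
  mn : ∀ (m : ℕ) (ξ : H), ‖ξ‖ = 1 → ∃ (n : ℕ) (f : H), ‖f‖ = 1 ∧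
    T (LB.sg m (rankOne ℂ ξ ξ)) = LB.sg n (rankOne ℂ f f)

/-- Diagonal matrix units. -/
noncomputable def ee (b : HilbertBasis ℕ ℂ H) (α : ℕ × ℕ) : LB H :=
  LB.sg α.1 (rankOne ℂ (b α.2) (b α.2))

lemma hb_norm (b : HilbertBasis ℕ ℂ H) (i : ℕ) : ‖b i‖ = 1 := b.orthonormal.1 i

lemma hb_inner (b : HilbertBasis ℕ ℂ H) (i j : ℕ) :
    inner ℂ (b i) (b j) = if i = j then (1 : ℂ) else 0 :=
  orthonormal_iff_ite.1 b.orthonormal i j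

lemma sg_mul_ne {m n : ℕ} (h : m ≠ n) (x y : H →L[ℂ] H) : LB.sg m x * LB.sg n y = 0 := by
  rw [LB.sg_mul_left, LB.sg_ap, if_neg h, mul_zero, LB.sg_zero]

lemma r1_mul (x y z w : H) :
    (rankOne ℂ x y) * (rankOne ℂ z w) = (inner ℂ y z : ℂ) • rankOne ℂ x w := by
  ext v; simp [smul_smul, mul_comm]

lemma r1_comp (x y z w : H) (A : H →L[ℂ] H) :
    (rankOne ℂ x y) * A * (rankOne ℂ z w) = (inner ℂ y (A z) : ℂ) • rankOne ℂ x w := by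
  ext v; simp [smul_smul, mul_comm]

lemma ee_mul (b : HilbertBasis ℕ ℂ H) (α β : ℕ × ℕ) :
    ee b α * ee b β = if α = β then ee b α else 0 := by
  obtain ⟨m, i⟩ := α
  obtain ⟨n, j⟩ := β
  by_cases h : m = n
  · subst h
    by_cases h' : i = j
    · subst h'; simp [ee, LB.sg_mul, r1_mul, hb_norm]
    · simp [ee, LB.sg_mul, r1_mul, hb_inner, h', LB.sg_zero]
  · rw [if_neg (by simp [h])]; exact sg_mul_ne h _ _

lemma ee_star (b : HilbertBasis ℕ ℂ H) (α : ℕ × ℕ) : star (ee b α) = ee b α := by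
  rw [ee, LB.sg_star, adj_rankOne]

lemma ortho_alg {p q : LB H} (h : p * p = p) (h' : p * q + q * p = 0) : p * q = 0 := by
  have e1 : p * q + p * q * p = 0 := by
    calc p * q + p * q * p = p * p * q + p * q * p := by rw [h]
      _ = p * (p * q + q * p) := by noncomm_ring
      _ = 0 := by rw [h', mul_zero]
  have e2 : p * q * p + p * q * p = 0 := by
    calc p * q * p + p * q * p = p * q * p + p * q * (p * p) := by rw [h]
      _ = (p * q + p * q * p) * p := by noncomm_ring
      _ = 0 := by rw [e1, zero_mul]
  have e3 : p * q * p = 0 := by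
    rw [← two_smul ℂ] at e2
    exact (smul_eq_zero.1 e2).resolve_left two_ne_zero
  rwa [e3, add_zero] at e1

variable {T : LB H →L[ℂ] LB H} (b : HilbertBasis ℕ ℂ H)

lemma pp_mul (hT : Good T) (α β : ℕ × ℕ) :
    T (ee b α) * T (ee b β) = if α = β then T (ee b α) else 0 := by
  by_cases h : α = β
  · subst h; rw [if_pos rfl, ← hT.jor.sq, ee_mul, if_pos rfl]
  · rw [if_neg h]
    apply ortho_alg
    · rw [← hT.jor.sq, ee_mul, if_pos rfl]
    · rw [← hT.jor.jmul, ee_mul, ee_mul, if_neg h, if_neg (Ne.symm h)]; simp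

lemma pp_star (hT : Good T) (α : ℕ × ℕ) : star (T (ee b α)) = T (ee b α) := by
  rw [← hT.jor.star, ee_star]

/-- off-diagonal matrix units -/
noncomputable def eij (b : HilbertBasis ℕ ℂ H) (m i j : ℕ) : LB H :=
  LB.sg m (rankOne ℂ (b i) (b j))

lemma eij_star (m i j : ℕ) : star (eij b m i j) = eij b m j i := by
  rw [eij, LB.sg_star, adj_rankOne]; rfl

lemma eij_ne (m i j : ℕ) : eij b m i j ≠ 0 := by
  intro h
  have := congrArg (fun x : LB H => x.ap m (b j)) h
  simp [eij, hb_norm] at this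
  have h2 := hb_norm b i
  rw [this] at h2; simp at h2

lemma lb_peirce (hT : Good T) (m : ℕ) {i j : ℕ} (h : i ≠ j) :
    T (eij b m i j) = T (ee b (m, i)) * T (eij b m i j) * T (ee b (m, j))
      + T (ee b (m, j)) * T (eij b m i j) * T (ee b (m, i)) := by
  rw [← hT.jor.triple']
  congr 1
  simp [ee, eij, LB.sg_mul, r1_mul, hb_inner, hb_norm, h.symm, LB.sg_zero]

lemma eij_sq (m : ℕ) {i j : ℕ} (h : i ≠ j) : eij b m i j * eij b m i j = 0 := by
  simp [eij, LB.sg_mul, r1_mul, hb_inner, h.symm, LB.sg_zero]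

lemma sg_inj_ne {n : ℕ} {f : H} (hf : ‖f‖ = 1) : LB.sg n (rankOne ℂ f f) ≠ 0 := by
  intro h
  have := congrArg (fun x : LB H => x.ap n f) h
  simp [hf] at this
  rw [this] at hf; simp at hf

/-- minimal projections in different fibres go to different fibres -/
lemma fibre_inj (hT : Good T) {m m' i j n n' : ℕ} {f f' : H} (hf : ‖f‖ = 1) (hf' : ‖f'‖ = 1)
    (h : T (ee b (m, i)) = LB.sg n (rankOne ℂ f f))
    (h' : T (ee b (m', j)) = LB.sg n' (rankOne ℂ f' f')) (hm : m ≠ m') : n ≠ n' := by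
  rintro rfl
  set z : LB H := LB.sg m 1 with hz
  have hzz : z * z = z := by rw [hz, LB.sg_mul, mul_one]
  have hzs : star z = z := by
    rw [hz, LB.sg_star]; congr 1; exact ContinuousLinearMap.adjoint_id
  have hzc : ∀ a, z * a = a * z := fun a => by
    rw [hz, LB.sg_mul_left, LB.sg_mul_right, one_mul, mul_one]
  have hc := hT.cent z hzc hzs hzz
  have k1 : z * ee b (m, i) = ee b (m, i) := by rw [hz, ee, LB.sg_mul, one_mul]
  have k2 : z * ee b (m', j) = 0 := sg_mul_ne hm _ _
  have k3 : T z * T (ee b (m, i)) = T (ee b (m, i)) := by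
    have := hT.jor.jmul z (ee b (m, i))
    rw [← hzc, k1, ← hc, map_add, ← two_smul ℂ, ← two_smul ℂ] at this
    exact (smul_right_injective _ (two_ne_zero (α := ℂ)) this).symm
  have k4 : T z * T (ee b (m', j)) = 0 := by
    have := hT.jor.jmul z (ee b (m', j))
    rw [← hzc, k2, ← hc, map_add, ← two_smul ℂ, ← two_smul ℂ, map_zero, smul_zero] at this
    exact (smul_eq_zero.1 this.symm).resolve_left two_ne_zero
  -- test with the rank one operator
  set c : LB H := LB.sg n (rankOne ℂ f' f) with hcdef
  have k5 : c * T (ee b (m, i)) = c := by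
    rw [h, hcdef, LB.sg_mul, r1_mul]; simp [hf]
  have k6 : T (ee b (m', j)) * c = c := by
    rw [h', hcdef, LB.sg_mul, r1_mul]; simp [hf']
  have k7 : c = 0 := by
    calc c = c * (T z * T (ee b (m, i))) := by rw [k3, k5]
      _ = (c * T z) * T (ee b (m, i)) := by rw [mul_assoc]
      _ = T z * (c * T (ee b (m, i))) := by rw [← hc, mul_assoc]
      _ = T z * (T (ee b (m', j)) * c) := by rw [k5, k6]
      _ = 0 := by rw [← mul_assoc, k4, zero_mul]
  have := congrArg (fun x : LB H => x.ap n f) k7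
  simp [hcdef, hf] at this
  rw [this] at hf'; simp at hf'

lemma sandwich (n : ℕ) (f g : H) (c : LB H) :
    LB.sg n (rankOne ℂ f f) * c * LB.sg n (rankOne ℂ g g)
      = (inner ℂ f (c.ap n g) : ℂ) • LB.sg n (rankOne ℂ f g) := by
  rw [LB.sg_mul_left, LB.sg_mul, r1_comp, LB.sg_smul]

lemma sandwich_ne {n n' : ℕ} (h : n ≠ n') (f g : H) (c : LB H) :
    LB.sg n (rankOne ℂ f f) * c * LB.sg n' (rankOne ℂ g g) = 0 := by
  rw [LB.sg_mul_left, sg_mul_ne h]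

lemma corner_range (hT : Good T) (α β : ℕ × ℕ) (c : LB H) :
    ∃ a, T a = T (ee b α) * c * T (ee b β) := by
  obtain ⟨m, i⟩ := α
  obtain ⟨m', j⟩ := β
  obtain ⟨n, f, hf, h⟩ := hT.mn m (b i) (hb_norm b i)
  obtain ⟨n', f', hf', h'⟩ := hT.mn m' (b j) (hb_norm b j)
  change T (ee b (m, i)) = _ at h
  change T (ee b (m', j)) = _ at h'
  by_cases hm : m = m'
  swap
  · have := fibre_inj b hT hf hf' h h' hm
    exact ⟨0, by rw [h, h', sandwich_ne this, map_zero]⟩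
  subst hm
  by_cases hij : i = j
  · subst hij
    refine ⟨(inner ℂ f (c.ap n f) : ℂ) • ee b (m, i), ?_⟩
    rw [map_smul, h, sandwich]
  have hp := lb_peirce b hT m hij
  have hy0 : T (eij b m i j) ≠ 0 := by
    rw [← norm_ne_zero_iff, hT.iso, norm_ne_zero_iff]; exact eij_ne b m i j
  have hst := hT.jor.star (eij b m i j)
  rw [eij_star] at hst
  have hsq := hT.jor.sq (eij b m i j)
  rw [eij_sq b m hij, map_zero] at hsq
  have hort := pp_mul b hT (m, i) (m, j)
  rw [if_neg (by simp [hij])] at hort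
  have hn : n = n' := by
    by_contra hn
    rw [h, h', sandwich_ne hn, sandwich_ne (Ne.symm hn), add_zero] at hp
    exact hy0 hp
  subst hn
  rw [h, h', sandwich, sandwich] at hp
  rw [h, h', sandwich]
  have hff : inner ℂ f f' = (0 : ℂ) := by
    have := congrArg (fun x : LB H => inner ℂ f (x.ap n f')) (h' ▸ h ▸ hort)
    simpa [hf, hf'] using this
  have hff' : inner ℂ f' f = (0 : ℂ) := by rw [← inner_conj_symm, hff, map_zero]
  set y := T (eij b m i j) with hy
  set s : ℂ := inner ℂ f (y.ap n f') with hs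
  set t : ℂ := inner ℂ f' (y.ap n f) with ht
  clear_value s t
  have hst0 : s * t = 0 := by
    rw [hp] at hsq
    have := congrArg (fun x : LB H => inner ℂ f' (x.ap n f')) hsq.symm
    simp [hf, hf', hff, hff', inner_smul_right] at this
    rcases this with h | h <;> simp [h]
  rcases mul_eq_zero.1 hst0 with h0 | h0
  · have ht0 : t ≠ 0 := by
      rintro rfl; apply hy0; rw [hp, h0]; simp
    rw [h0, zero_smul, zero_add] at hp
    rw [hp, star_smul, LB.sg_star, adj_rankOne] at hst
    refine ⟨(inner ℂ f (c.ap n f') * (star t)⁻¹ : ℂ) • eij b m j i, ?_⟩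
    rw [map_smul, hst, smul_smul, mul_assoc, inv_mul_cancel₀ (by simpa using ht0), mul_one]
  · have ht0 : s ≠ 0 := by
      rintro rfl; apply hy0; rw [hp, h0]; simp
    rw [h0, zero_smul, add_zero] at hp
    refine ⟨(inner ℂ f (c.ap n f') * s⁻¹ : ℂ) • eij b m i j, ?_⟩
    rw [map_smul, ← hy, hp, smul_smul, mul_assoc, inv_mul_cancel₀ ht0, mul_one]

end peirce

section complete
variable {H : Type*} [NormedAddCommGroup H] [InnerProductSpace ℂ H] [CompleteSpace H] [Nontrivial H]
open InnerProductSpace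

lemma countable_of_orthonormal [TopologicalSpace.SeparableSpace H] {ι : Type*} {g : ι → H}
    (hg : Orthonormal ℂ g) : Countable ι := by
  refine Pairwise.countable_of_isOpen_disjoint (s := fun i => Metric.ball (g i) (1 / 2)) ?_
    (fun i => Metric.isOpen_ball) (fun i => Metric.nonempty_ball.2 (by norm_num))
  intro i j hij
  apply Metric.ball_disjoint_ball
  have h1 : ‖g i - g j‖ ^ 2 = 2 := by
    rw [@norm_sub_sq ℂ, hg.2 hij, hg.1 i, hg.1 j]; norm_num
  rw [dist_eq_norm]
  nlinarith [norm_nonneg (g i - g j)]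

lemma countable_of_orthogonal [TopologicalSpace.SeparableSpace H] {ι : Type*} {g : ι → H}
    (h0 : ∀ i, g i ≠ 0) (hg : ∀ i j, i ≠ j → inner ℂ (g i) (g j) = (0 : ℂ)) : Countable ι := by
  refine countable_of_orthonormal (g := fun i => ((‖g i‖⁻¹ : ℝ) : ℂ) • g i) ⟨fun i => ?_, ?_⟩
  · rw [norm_smul]
    have := norm_ne_zero_iff.2 (h0 i)
    simp [this]
  · intro i j hij
    simp [inner_smul_left, inner_smul_right, hg i j hij]

lemma exists_shift (b : HilbertBasis ℕ ℂ H) (s : ℕ → ℕ) (hs : Function.Injective s) :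
    ∃ V : H →L[ℂ] H, ‖V‖ ≤ 1 ∧ ContinuousLinearMap.adjoint V * V = 1 ∧
      (∀ i, i ∈ Set.range s → (V * ContinuousLinearMap.adjoint V) (b i) = b i) ∧
      (∀ i, i ∉ Set.range s → (V * ContinuousLinearMap.adjoint V) (b i) = 0) := by
  have ho : Orthonormal ℂ (b ∘ s) := b.orthonormal.comp s hs
  let U : H →ₗᵢ[ℂ] H := ho.orthogonalFamily.linearIsometry.comp b.repr.toLinearIsometry
  have hU : ∀ k, U (b k) = b (s k) := by
    intro k
    change ho.orthogonalFamily.linearIsometry (b.repr (b k)) = _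
    rw [b.repr_self]
    erw [ho.orthogonalFamily.linearIsometry_apply_single]
    simp
  let V : H →L[ℂ] H := U.toContinuousLinearMap
  have hVU : ∀ v, V v = U v := fun v => rfl
  have hVV : ContinuousLinearMap.adjoint V * V = 1 := by
    ext v
    apply ext_inner_left ℂ
    intro w
    rw [ContinuousLinearMap.mul_apply, ContinuousLinearMap.adjoint_inner_right, hVU, hVU,
      U.inner_map_map]; rfl
  refine ⟨V, U.norm_toContinuousLinearMap_le, hVV, ?_, ?_⟩
  · rintro _ ⟨k, rfl⟩
    have := congrArg (fun A : H →L[ℂ] H => V (A (b k))) hVV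
    simp only [ContinuousLinearMap.mul_apply, hVU, hU] at this
    simpa [hVU, hU] using this
  · intro i hi
    have : ContinuousLinearMap.adjoint V (b i) = 0 := by
      have hz : b.repr (ContinuousLinearMap.adjoint V (b i)) = 0 := by
        ext k
        rw [b.repr_apply_apply, ContinuousLinearMap.adjoint_inner_right, hVU, hU, hb_inner,
          if_neg]
        · rfl
        · exact fun h => hi ⟨k, h⟩
      exact (LinearIsometryEquiv.map_eq_zero_iff b.repr).1 hz
    rw [ContinuousLinearMap.mul_apply, this, map_zero]

/-- codes of initial segments -/
def code (x : ℕ → Bool) (l : ℕ) : ℕ := Encodable.encode ((List.range l).map x)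

lemma code_inj {x y : ℕ → Bool} {l l' : ℕ} (h : code x l = code y l') :
    l = l' ∧ ∀ k < l, x k = y k := by
  have h1 := Encodable.encode_injective h
  have h2 : l = l' := by simpa using congrArg List.length h1
  subst h2
  refine ⟨rfl, fun k hk => ?_⟩
  have := List.map_inj_left.1 h1 k (List.mem_range.2 hk)
  exact this

lemma exists_family (b : HilbertBasis ℕ ℂ H) :
    ∃ W : (ℕ → Bool) → LB H, (∀ x, star (W x) * W x = 1) ∧
      ∀ x y, x ≠ y → ∃ F : Finset (ℕ × ℕ),
        (W x * star (W x)) * (W y * star (W y)) = ∑ α ∈ F, ee b α := by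
  classical
  have hinj : ∀ (x : ℕ → Bool) (m : ℕ), Function.Injective (fun k => code x (m + k)) := by
    intro x m k l h
    have := (code_inj h).1
    omega
  choose V hV1 hV2 hV3 hV4 using fun (x : ℕ → Bool) (m : ℕ) => exists_shift b _ (hinj x m)
  refine ⟨fun x => LB.mk (V x) 1 (hV1 x), fun x => LB.ext fun n => hV2 x n, ?_⟩
  intro x y hxy
  obtain ⟨N, hN⟩ := Function.ne_iff.1 hxy
  set S : (ℕ → Bool) → ℕ → Set ℕ := fun x m => Set.range (fun k => code x (m + k)) with hS
  have hfin : Set.Finite {α : ℕ × ℕ | α.2 ∈ S x α.1 ∧ α.2 ∈ S y α.1} := by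
    apply Set.Finite.subset (((Finset.range (N + 1)) ×ˢ
      ((Finset.range (N + 1)).image (code x)) : Finset (ℕ × ℕ)).finite_toSet)
    rintro ⟨m, i⟩ ⟨⟨k, hk⟩, ⟨l, hl⟩⟩
    simp only at hk hl
    have h := code_inj (hk.trans hl.symm)
    have hle : m + k ≤ N := by
      by_contra hcon
      exact hN (h.2 N (by omega))
    simp only [Finset.coe_product, Finset.coe_image, Set.mem_prod, Finset.coe_range,
      Set.mem_Iio, Set.mem_image]
    exact ⟨by omega, m + k, by omega, hk⟩
  refine ⟨hfin.toFinset, ?_⟩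
  apply LB.ext
  intro m
  apply ContinuousLinearMap.ext_on (s := Set.range b)
  · exact (Submodule.dense_iff_topologicalClosure_eq_top).2 b.dense_span
  rintro _ ⟨i, rfl⟩
  have hsum : (∑ α ∈ hfin.toFinset, ee b α).ap m (b i)
      = if (m, i) ∈ hfin.toFinset then b i else 0 := by
    have e1 : (∑ α ∈ hfin.toFinset, ee b α).ap m = ∑ α ∈ hfin.toFinset, (ee b α).ap m := by
      rw [← LB.apL_apply, map_sum]; rfl
    rw [e1, ContinuousLinearMap.sum_apply]
    have e2 : ∀ α ∈ hfin.toFinset, (ee b α).ap m (b i) = if α = (m, i) then b i else 0 := by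
      rintro ⟨n, j⟩ -
      by_cases hn : m = n
      · subst hn
        by_cases hj : j = i
        · subst hj; simp [ee, hb_norm]
        · simp [ee, hj, hb_inner]
      · rw [if_neg (by simp; intro h; exact absurd h.symm hn)]
        simp [ee, LB.sg_ap, hn]
    rw [Finset.sum_congr rfl e2]
    simp
  rw [hsum]
  change (V x m * ContinuousLinearMap.adjoint (V x m))
    ((V y m * ContinuousLinearMap.adjoint (V y m)) (b i)) = _
  by_cases hy : i ∈ S y m
  · rw [hV3 y m i hy]
    by_cases hx : i ∈ S x m
    · rw [hV3 x m i hx, if_pos]; simpa using ⟨hx, hy⟩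
    · rw [hV4 x m i hx, if_neg]; simp [hx]
  · rw [hV4 y m i hy, map_zero, if_neg]; simp [hy]

variable {T : LB H →L[ℂ] LB H} (b : HilbertBasis ℕ ℂ H)

lemma kill_eij (hT : Good T) {n : ℕ} {v : H} (hv : ∀ α, (T (ee b α)).ap n v = 0) (m i j : ℕ) :
    (T (eij b m i j)).ap n v = 0 := by
  by_cases h : i = j
  · subst h; exact hv (m, i)
  · rw [lb_peirce b hT m h]
    simp [hv]

lemma hb_dense : Dense (Submodule.span ℂ (Set.range b) : Set H) :=
  (Submodule.dense_iff_topologicalClosure_eq_top).2 b.dense_span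

lemma kill_left (hT : Good T) {n : ℕ} {v : H} (hv : ∀ α, (T (ee b α)).ap n v = 0) (m i : ℕ)
    (η : H) : (T (LB.sg m (rankOne ℂ η (b i)))).ap n v = 0 := by
  let L : H →L[ℂ] H := (ContinuousLinearMap.apply ℂ H v).comp ((LB.apL n).comp (T.comp
    ((LB.sgL m).comp ((rankOne ℂ).flip (b i)))))
  have : L = 0 := by
    apply ContinuousLinearMap.ext_on (hb_dense b)
    rintro _ ⟨j, rfl⟩
    exact kill_eij b hT hv m j i
  exact congrArg (fun L : H →L[ℂ] H => L η) this

lemma kill_right (hT : Good T) {n : ℕ} {v : H} (hv : ∀ α, (T (ee b α)).ap n v = 0) (m i : ℕ)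
    (η : H) : (T (LB.sg m (rankOne ℂ (b i) η))).ap n v = 0 := by
  let L0 : (H →L[ℂ] H) →L[ℂ] H := (ContinuousLinearMap.apply ℂ H v).comp ((LB.apL n).comp (T.comp
    (LB.sgL m)))
  let L : H →L⋆[ℂ] H := L0.comp (rankOne ℂ (b i))
  have : L = 0 := by
    apply ContinuousLinearMap.ext_on (hb_dense b)
    rintro _ ⟨j, rfl⟩
    exact kill_eij b hT hv m i j
  exact congrArg (fun L : H →L⋆[ℂ] H => L η) this

lemma r1_mul_right (x y : H) (A : H →L[ℂ] H) :
    (rankOne ℂ x y) * A = rankOne ℂ x (ContinuousLinearMap.adjoint A y) := by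
  ext v; simp [ContinuousLinearMap.adjoint_inner_left]

lemma r1_mul_left (x y : H) (A : H →L[ℂ] H) :
    A * (rankOne ℂ x y) = rankOne ℂ (A x) y := by
  ext v; simp

lemma kill_inv (hT : Good T) {n : ℕ} {v : H} (hv : ∀ α, (T (ee b α)).ap n v = 0) (A : LB H)
    (α : ℕ × ℕ) : (T (ee b α)).ap n ((T A).ap n v) = 0 := by
  have h := congrArg (fun x : LB H => x.ap n v) (hT.jor.jmul (ee b α) A)
  have h1 : (T (ee b α * A)).ap n v = 0 := by
    rw [ee, LB.sg_mul_left, r1_mul_right]; exact kill_right b hT hv _ _ _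
  have h2 : (T (A * ee b α)).ap n v = 0 := by
    rw [ee, LB.sg_mul_right, r1_mul_left]; exact kill_left b hT hv _ _ _
  simp only [map_add, LB.ap_add, LB.ap_mul, ContinuousLinearMap.add_apply,
    ContinuousLinearMap.mul_apply, h1, h2, hv, map_zero, add_zero] at h
  exact h.symm

lemma pp_complete [TopologicalSpace.SeparableSpace H] (hT : Good T) {n : ℕ} {v₀ : H}
    (hv₀ : ∀ α, (T (ee b α)).ap n v₀ = 0) : v₀ = 0 := by
  obtain ⟨W, hW, hWW⟩ := exists_family b
  set P : (ℕ → Bool) → LB H := fun x => W x * star (W x) with hP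
  have hPs : ∀ x, star (P x) = P x := fun x => by simp [hP]
  have hPP : ∀ x, P x * P x = P x := fun x => by
    simp only [hP]
    calc W x * star (W x) * (W x * star (W x)) = W x * (star (W x) * W x) * star (W x) := by
          noncomm_ring
      _ = _ := by rw [hW, mul_one]
  have hPort : ∀ x y, x ≠ y → ∀ v, (∀ α, (T (ee b α)).ap n v = 0) →
      (T (P x)).ap n ((T (P y)).ap n v) = 0 := by
    intro x y hxy v hv
    obtain ⟨F, hF⟩ := hWW x y hxy
    change P x * P y = _ at hF
    have hF' : P y * P x = ∑ α ∈ F, ee b α := by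
      have := congrArg star hF
      rw [star_mul, hPs, hPs, star_sum] at this
      rw [this]
      exact Finset.sum_congr rfl fun α _ => ee_star b α
    have hk : ∀ u, (∀ α, (T (ee b α)).ap n u = 0) → (T (∑ α ∈ F, ee b α)).ap n u = 0 := by
      intro u hu
      rw [map_sum, ← LB.apL_apply, map_sum, ContinuousLinearMap.sum_apply]
      exact Finset.sum_eq_zero fun α _ => hu α
    have hjm : ∀ u, (∀ α, (T (ee b α)).ap n u = 0) →
        (T (P x)).ap n ((T (P y)).ap n u) + (T (P y)).ap n ((T (P x)).ap n u) = 0 := by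
      intro u hu
      have h := congrArg (fun z : LB H => z.ap n u) (hT.jor.jmul (P x) (P y))
      simp only [hF, hF', map_add, LB.ap_add, LB.ap_mul, ContinuousLinearMap.add_apply,
        ContinuousLinearMap.mul_apply, hk u hu, add_zero] at h
      exact h.symm
    have hid : ∀ u, (T (P x)).ap n ((T (P x)).ap n u) = (T (P x)).ap n u := by
      intro u
      have h := congrArg (fun z : LB H => z.ap n u) (hT.jor.sq (P x))
      rw [hPP] at h
      exact h.symm
    have a1 := hjm v hv
    have a2 := congrArg (fun z => (T (P x)).ap n z) a1
    have a3 := hjm ((T (P x)).ap n v) (kill_inv b hT hv _)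
    simp only [map_add, map_zero, hid] at a2 a3
    -- a2 : p q v + p q p v = 0 ; a3 : p q p v + q p v = 0
    have a4 : (T (P x)).ap n ((T (P y)).ap n v) - (T (P y)).ap n ((T (P x)).ap n v) = 0 := by
      have := congrArg₂ (fun s t => s - t) a2 a3
      simp only [sub_zero] at this
      rw [← this]; abel
    have a5 : (2 : ℂ) • (T (P x)).ap n ((T (P y)).ap n v) = 0 := by
      have := congrArg₂ (fun s t => s + t) a1 a4
      simp only [add_zero] at this
      rw [← this, two_smul]; abel
    exact (smul_eq_zero.1 a5).resolve_left two_ne_zero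
  by_contra hne
  have hsa : ∀ a : LB H, star a = a → ∀ u w : H,
      inner ℂ ((T a).ap n u) w = (inner ℂ u ((T a).ap n w) : ℂ) := by
    intro a ha u w
    have h := hT.jor.star a
    rw [ha] at h
    rw [← ContinuousLinearMap.adjoint_inner_right, ← LB.ap_star, ← h]
  have hex : ∀ x, ∃ u, (∀ α, (T (ee b α)).ap n u = 0) ∧ (T (P x)).ap n u ≠ 0 := by
    intro x
    by_contra hcon
    push Not at hcon
    have ht := hT.jor.triple' (star (W x)) (P x) (W x)
    have e1 : star (W x) * P x * W x = 1 := by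
      simp only [hP]
      calc star (W x) * (W x * star (W x)) * W x = (star (W x) * W x) * (star (W x) * W x) := by
            noncomm_ring
        _ = 1 := by rw [hW, mul_one]
    set R := W x * P x * star (W x) with hR
    have hRs : star R = R := by simp [hR, hPs, mul_assoc]
    have hRR : R * R = R := by
      calc R * R = W x * (P x * (star (W x) * W x) * P x) * star (W x) := by
            rw [hR]; noncomm_ring
        _ = R := by rw [hW, mul_one, hPP]
    rw [e1, map_add, hT.jor.one] at ht
    have h1 := congrArg (fun z : LB H => z.ap n v₀) ht
    simp only [LB.ap_add, LB.ap_mul, LB.ap_one, ContinuousLinearMap.add_apply,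
      ContinuousLinearMap.mul_apply, ContinuousLinearMap.one_apply,
      hcon _ (kill_inv b hT hv₀ (W x)), hcon _ (kill_inv b hT hv₀ (star (W x))),
      map_zero, add_zero] at h1
    have h2 := hT.jor.sq R
    rw [hRR] at h2
    have h3 : inner ℂ v₀ v₀ + (inner ℂ ((T R).ap n v₀) ((T R).ap n v₀) : ℂ) = 0 := by
      rw [hsa R hRs, ← ContinuousLinearMap.mul_apply, ← LB.ap_mul, ← h2, ← inner_add_right, h1,
        inner_zero_right]
    have h4 := congrArg Complex.re h3
    rw [inner_self_eq_norm_sq_to_K, inner_self_eq_norm_sq_to_K] at h4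
    norm_cast at h4
    have h5 : 0 < ‖v₀‖ := norm_pos_iff.2 hne
    have h4' : ‖v₀‖ ^ 2 + ‖(T R).ap n v₀‖ ^ 2 = 0 := by exact_mod_cast h4
    nlinarith [sq_nonneg ‖(T R).ap n v₀‖]
  choose u hu1 hu2 using hex
  have hc : Countable (ℕ → Bool) := by
    apply countable_of_orthogonal (g := fun x => (T (P x)).ap n (u x)) hu2
    intro x y hxy
    rw [hsa _ (hPs x), hPort x y hxy _ (hu1 y), inner_zero_right]
  obtain ⟨g, hg⟩ := exists_surjective_nat (ℕ → Bool)
  obtain ⟨k, hk⟩ := hg (fun i => !(g i i))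
  have := congrFun hk k
  simp at this

end complete

section final
variable {H : Type*} [NormedAddCommGroup H] [InnerProductSpace ℂ H] [CompleteSpace H] [Nontrivial H]
open InnerProductSpace Filter Topology

lemma exists_basis [TopologicalSpace.SeparableSpace H] (hinf : ¬ FiniteDimensional ℂ H) :
    Nonempty (HilbertBasis ℕ ℂ H) := by
  obtain ⟨w, b, -⟩ := exists_hilbertBasis ℂ H
  have hc : Countable w := countable_of_orthonormal b.orthonormal
  have hi : Infinite w := by
    by_contra h
    rw [not_infinite_iff_finite] at h
    have := Fintype.ofFinite w
    exact hinf (Module.Finite.of_basis b.toOrthonormalBasis.toBasis)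
  obtain ⟨e⟩ := nonempty_equiv_of_countable (α := ℕ) (β := w)
  refine ⟨HilbertBasis.mk (v := b ∘ e) (b.orthonormal.comp e e.injective) ?_⟩
  rw [Set.range_comp, e.surjective.range_eq, Set.image_univ, b.dense_span]

/-- weak operator limits along ultrafilters -/
lemma exists_wot {ι : Type*} (U : Ultrafilter ι) (A : ι → LB H) (C : ℝ)
    (hA : ∀ F, ‖A F‖ ≤ C) : ∃ L : LB H, ∀ n v w,
      Tendsto (fun F => (inner ℂ ((A F).ap n v) w : ℂ)) U (𝓝 (inner ℂ (L.ap n v) w)) := by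
  have hbd : ∀ n v w F, ‖(inner ℂ ((A F).ap n v) w : ℂ)‖ ≤ C * ‖v‖ * ‖w‖ := by
    intro n v w F
    refine (norm_inner_le_norm _ _).trans ?_
    gcongr
    exact ((A F).le_norm n v).trans (by gcongr; exact hA F)
  have hlim : ∀ n v w, ∃ l : ℂ, ‖l‖ ≤ C * ‖v‖ * ‖w‖ ∧
      Tendsto (fun F => (inner ℂ ((A F).ap n v) w : ℂ)) U (𝓝 l) := by
    intro n v w
    have hK := isCompact_closedBall (0 : ℂ) (C * ‖v‖ * ‖w‖)
    have := hK.ultrafilter_le_nhds (U.map fun F => (inner ℂ ((A F).ap n v) w : ℂ)) (by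
      rw [Ultrafilter.coe_map, le_principal_iff]
      exact Filter.mem_map.2 (Eventually.of_forall fun F => by simpa using hbd n v w F))
    obtain ⟨l, hl, hl'⟩ := this
    exact ⟨l, by simpa using hl, hl'⟩
  choose l hl hlt using hlim
  have huniq : ∀ n v w {c : ℂ}, Tendsto (fun F => (inner ℂ ((A F).ap n v) w : ℂ)) U (𝓝 c) →
      l n v w = c := fun n v w c h => tendsto_nhds_unique (hlt n v w) h
  let B : ℕ → H →L⋆[ℂ] H →L[ℂ] ℂ := fun n => LinearMap.mkContinuous₂
    (LinearMap.mk₂'ₛₗ (starRingEnd ℂ) (RingHom.id ℂ) (l n)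
      (fun v v' w => huniq _ _ _ (by
        simpa only [map_add, inner_add_left] using (hlt n v w).add (hlt n v' w)))
      (fun c v w => huniq _ _ _ (by
        simpa only [map_smul, inner_smul_left, smul_eq_mul] using (hlt n v w).const_mul _))
      (fun v w w' => huniq _ _ _ (by
        simpa only [inner_add_right] using (hlt n v w).add (hlt n v w')))
      (fun c v w => huniq _ _ _ (by
        simpa only [inner_smul_right, smul_eq_mul, RingHom.id_apply] using (hlt n v w).const_mul _))) C (fun v w => hl n v w)
  have hC : 0 ≤ C := by
    obtain ⟨F, -⟩ := U.nonempty_of_mem (univ_mem)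
    exact (norm_nonneg _).trans (hA F)
  have hB : ∀ n v w, (inner ℂ (continuousLinearMapOfBilin (B n) v) w : ℂ) = l n v w := by
    intro n v w; rw [continuousLinearMapOfBilin_apply]; rfl
  refine ⟨LB.mk (fun n => continuousLinearMapOfBilin (B n)) C fun n => ?_, fun n v w => ?_⟩
  · apply ContinuousLinearMap.opNorm_le_bound _ hC
    intro v
    set u := continuousLinearMapOfBilin (B n) v with hu
    have h1 := hl n v u
    rw [← hB, ← hu, inner_self_eq_norm_sq_to_K] at h1
    simp only [Complex.coe_algebraMap, norm_pow, Complex.norm_real, norm_norm] at h1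
    by_cases h0 : ‖u‖ = 0
    · rw [h0]; positivity
    · have : 0 < ‖u‖ := lt_of_le_of_ne (norm_nonneg _) (Ne.symm h0)
      nlinarith
  · rw [LB.mk_ap, hB]; exact hlt n v w

variable {T : LB H →L[ℂ] LB H} (b : HilbertBasis ℕ ℂ H)

/-- matrix units indexed by pairs -/
noncomputable def mu (α β : ℕ × ℕ) : LB H :=
  if α.1 = β.1 then LB.sg α.1 (rankOne ℂ (b α.2) (b β.2)) else 0

lemma ee_sandwich (α β : ℕ × ℕ) (A : LB H) :
    ee b α * A * ee b β = (inner ℂ (b α.2) (A.ap α.1 (b β.2)) : ℂ) • mu b α β := by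
  obtain ⟨m, i⟩ := α
  obtain ⟨n, j⟩ := β
  by_cases h : m = n
  · subst h; simp only [mu, if_true]; exact sandwich _ _ _ _
  · simp only [mu, if_neg h, smul_zero]; exact sandwich_ne h _ _ _

lemma good_surj (b : HilbertBasis ℕ ℂ H) [TopologicalSpace.SeparableSpace H] (hT : Good T) : Function.Surjective T := by
  classical
  intro c
  set Q : Finset (ℕ × ℕ) → LB H := fun F => ∑ α ∈ F, T (ee b α) with hQ
  have hpQ : ∀ F α, α ∈ F → T (ee b α) * Q F = T (ee b α) := by
    intro F α hα
    rw [hQ]; simp only [Finset.mul_sum, pp_mul b hT]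
    simp [hα]
  have hQp : ∀ F α, α ∈ F → Q F * T (ee b α) = T (ee b α) := by
    intro F α hα
    rw [hQ]; simp only [Finset.sum_mul, pp_mul b hT]
    simp [hα]
  have hQQ : ∀ F, Q F * Q F = Q F := by
    intro F
    conv_lhs => lhs; rw [hQ]
    simp only [Finset.sum_mul]
    exact Finset.sum_congr rfl fun α hα => hpQ F α hα
  have hQs : ∀ F, star (Q F) = Q F := by
    intro F
    simp only [hQ, star_sum, pp_star b hT]
  have hQn : ∀ F, ‖Q F‖ ≤ 1 := fun F => proj_norm (hQQ F) (hQs F)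
  have hex : ∀ F, ∃ a, T a = Q F * c * Q F := by
    intro F
    have : Q F * c * Q F ∈ LinearMap.range T.toLinearMap := by
      simp only [hQ, Finset.sum_mul, Finset.mul_sum]
      refine Submodule.sum_mem _ fun α _ => Submodule.sum_mem _ fun β _ => ?_
      obtain ⟨a, ha⟩ := corner_range b hT β α c
      exact ⟨a, ha⟩
    obtain ⟨a, ha⟩ := this
    exact ⟨a, ha⟩
  choose A hA using hex
  have hAn : ∀ F, ‖A F‖ ≤ ‖c‖ := by
    intro F
    rw [← hT.iso, hA]
    calc ‖Q F * c * Q F‖ ≤ ‖Q F * c‖ * ‖Q F‖ := norm_mul_le _ _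
      _ ≤ (‖Q F‖ * ‖c‖) * ‖Q F‖ := by gcongr; exact norm_mul_le _ _
      _ ≤ (1 * ‖c‖) * 1 := by gcongr <;> exact hQn F
      _ = ‖c‖ := by ring
  let U : Ultrafilter (Finset (ℕ × ℕ)) := Ultrafilter.of atTop
  have hU : (U : Filter (Finset (ℕ × ℕ))) ≤ atTop := Ultrafilter.of_le _
  obtain ⟨L, hL⟩ := exists_wot U A ‖c‖ hAn
  have hs : ∀ α β, Tendsto (fun F => ee b α * A F * ee b β) U (𝓝 (ee b α * L * ee b β)) := by
    intro α β
    simp only [ee_sandwich]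
    refine Tendsto.smul_const ?_ _
    have := (Complex.continuous_conj.tendsto _).comp (hL α.1 (b β.2) (b α.2))
    simpa only [Function.comp_def, inner_conj_symm] using this
  have hkey : ∀ α β, T (ee b α) * T L * T (ee b β) + T (ee b β) * T L * T (ee b α)
      = T (ee b α) * c * T (ee b β) + T (ee b β) * c * T (ee b α) := by
    intro α β
    rw [← hT.jor.triple']
    have h1 := (T.continuous.tendsto _).comp ((hs α β).add (hs β α))
    refine tendsto_nhds_unique h1 (tendsto_const_nhds.congr' ?_)
    have h2 : ∀ᶠ F in (U : Filter (Finset (ℕ × ℕ))), {α, β} ⊆ F := 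
      (eventually_ge_atTop ({α, β} : Finset (ℕ × ℕ))).filter_mono hU
    filter_upwards [h2] with F hF
    have hα : α ∈ F := hF (by simp)
    have hβ : β ∈ F := hF (by simp)
    have e1 : ∀ γ δ, γ ∈ F → δ ∈ F → T (ee b γ) * (Q F * c * Q F) * T (ee b δ)
        = T (ee b γ) * c * T (ee b δ) := by
      intro γ δ hγ hδ
      calc T (ee b γ) * (Q F * c * Q F) * T (ee b δ)
          = (T (ee b γ) * Q F) * c * (Q F * T (ee b δ)) := by simp only [mul_assoc]
        _ = _ := by rw [hpQ F γ hγ, hQp F δ hδ]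
    rw [Function.comp_apply, hT.jor.triple', hA, e1 α β hα hβ, e1 β α hβ hα]
  set d := T L - c with hd
  have hd1 : ∀ α β, T (ee b α) * d * T (ee b β) + T (ee b β) * d * T (ee b α) = 0 := by
    intro α β
    have : T (ee b α) * d * T (ee b β) + T (ee b β) * d * T (ee b α)
      = (T (ee b α) * T L * T (ee b β) + T (ee b β) * T L * T (ee b α))
        - (T (ee b α) * c * T (ee b β) + T (ee b β) * c * T (ee b α)) := by
      rw [hd]; noncomm_ring
    rw [this, hkey, sub_self]
  have hd2 : ∀ α β, T (ee b α) * d * T (ee b β) = 0 := by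
    intro α β
    have h := hd1 α β
    by_cases hαβ : α = β
    · subst hαβ
      rw [← two_smul ℂ] at h
      exact (smul_eq_zero.1 h).resolve_left two_ne_zero
    · have h2 := congrArg (fun z => T (ee b α) * z) h
      simp only [mul_add, ← mul_assoc, pp_mul b hT, if_true, if_neg hαβ, zero_mul, add_zero,
        mul_zero] at h2
      exact h2
  have hd3 : ∀ β, d * T (ee b β) = 0 := by
    intro β
    apply LB.ext'
    intro n v
    apply pp_complete b hT (n := n)
    intro α
    have := congrArg (fun z : LB H => z.ap n v) (hd2 α β)
    rw [mul_assoc] at this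
    exact this
  have hd4 : star d = 0 := by
    apply LB.ext'
    intro n v
    apply pp_complete b hT (n := n)
    intro α
    have h := congrArg star (hd3 α)
    rw [star_mul, pp_star b hT, star_zero] at h
    exact congrArg (fun z : LB H => z.ap n v) h
  exact ⟨L, sub_eq_zero.1 (star_eq_zero.1 hd4)⟩

theorem main_LB [TopologicalSpace.SeparableSpace H] (hinf : ¬ FiniteDimensional ℂ H)
    (Φ : LB H →L[ℂ] LB H)
    (hloc : ∀ x : LB H, Φ x ∈ closure {y | ∃ Ψ : LB H →ₗ[ℂ] LB H,
        Function.Surjective Ψ ∧ (∀ a, ‖Ψ a‖ = ‖a‖) ∧ y = Ψ x}) :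
    Function.Surjective Φ ∧ ∀ a, ‖Φ a‖ = ‖a‖ := by
  have hcl : ∀ (S : Set (LB H)) (x : LB H), IsClosed S →
      (∀ Ψ : LB H →ₗ[ℂ] LB H, Function.Surjective Ψ → (∀ a, ‖Ψ a‖ = ‖a‖) → Ψ x ∈ S) →
      Φ x ∈ S := by
    intro S x hS h
    refine closure_minimal ?_ hS (hloc x)
    rintro _ ⟨Ψ, h1, h2, rfl⟩
    exact h Ψ h1 h2
  have hiso : ∀ a, ‖Φ a‖ = ‖a‖ := fun a =>
    hcl {y | ‖y‖ = ‖a‖} a (isClosed_eq continuous_norm continuous_const) fun Ψ _ h => h a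
  refine ⟨?_, hiso⟩
  have hun : ∀ u ∈ unitary (LB H), Φ u ∈ unitary (LB H) := fun u hu =>
    hcl _ u isClosed_unitary fun Ψ h1 h2 => surj_isom_unitary Ψ h1 h2 hu
  set w := Φ 1 with hw
  have hwu : w ∈ unitary (LB H) := hun 1 (one_mem _)
  have hw1 : star w * w = 1 := (Unitary.mem_iff.1 hwu).1
  have hw2 : w * star w = 1 := (Unitary.mem_iff.1 hwu).2
  let T : LB H →L[ℂ] LB H := (ContinuousLinearMap.mul ℂ (LB H) (star w)).comp Φ
  have hTa : ∀ a, T a = star w * Φ a := fun a => rfl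
  have hwn : ∀ a : LB H, ‖star w * a‖ = ‖a‖ := by
    intro a
    have := CStarRing.norm_mem_unitary_mul a (Unitary.star_mem hwu)
    exact this
  have hJ : IsJor T := by
    apply isJor_of_unitary
    · rw [hTa, ← hw, hw1]
    · intro u hu
      exact mul_mem (Unitary.star_mem hwu) (hun u hu)
  have hTiso : ∀ a, ‖T a‖ = ‖a‖ := fun a => by rw [hTa, hwn, hiso]
  have hG : Good T := by
    refine ⟨hJ, hTiso, ?_, ?_⟩
    · intro z hz hzs hzz c
      have h1 : (star (Φ z) * Φ z) * c = c * (star (Φ z) * Φ z) :=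
        hcl {y | (star y * y) * c = c * (star y * y)} z
          (isClosed_eq (by fun_prop) (by fun_prop))
          fun Ψ h1 h2 => surj_isom_central Ψ h1 h2 hz hzs hzz c
      have h2 : star (Φ z) * Φ z = T z := by
        calc star (Φ z) * Φ z = star (Φ z) * (w * star w) * Φ z := by rw [hw2, mul_one]
          _ = star (T z) * T z := by rw [hTa, star_mul, star_star]; simp only [mul_assoc]
          _ = T z := by rw [← hJ.star, hzs, ← hJ.sq, hzz]
      rwa [h2] at h1
    · intro m ξ hξ
      set e : LB H := LB.sg m (rankOne ℂ ξ ξ) with he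
      have hee : e * e = e := by
        rw [he, LB.sg_mul]; congr 1; exact isIdempotentElem_rankOne_self hξ
      have hes : star e = e := by rw [he, LB.sg_star, adj_rankOne]
      have hne : T e ≠ 0 := by
        rw [← norm_ne_zero_iff, hTiso, norm_ne_zero_iff]; exact sg_inj_ne hξ
      apply min_of_sm hne (by rw [← hJ.sq, hee]) (by rw [← hJ.star, hes])
      have h1 : Sm (Φ e) := hcl _ e sm_closed fun Ψ h1 h2 => sm_isom Ψ h1 h2 (sm_min m hξ)
      intro y hy
      have h2 := h1 (w * y) (by
        rw [CStarRing.norm_mem_unitary_mul y hwu]; exact hy)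
      have e1 : ∀ s : ℂ, ‖T e + s • y‖ = ‖Φ e + s • (w * y)‖ := by
        intro s
        rw [← hwn (Φ e + s • (w * y)), mul_add, mul_smul_comm, ← mul_assoc, hw1, one_mul, hTa]
      rw [e1, sub_eq_add_neg (T e), ← neg_smul, e1, neg_smul, ← sub_eq_add_neg]
      exact h2
  obtain ⟨b⟩ := exists_basis hinf
  intro c
  obtain ⟨a, ha⟩ := good_surj b hG (star w * c)
  refine ⟨a, ?_⟩
  calc Φ a = w * T a := by rw [hTa, ← mul_assoc, hw2, one_mul]
    _ = c := by rw [ha, ← mul_assoc, hw2, one_mul]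

end final


/-- Let `H` be a complex separable infinite-dimensional Hilbert space. The
isometry group of `ℓ∞(ℕ, B(H))` is topologically reflexive: if `Φ` is a bounded
complex-linear map on `ℓ∞(ℕ, B(H))` such that for every `A` the element `Φ(A)` belongs to
the norm-closure of `{Ψ(A) : Ψ a surjective linear isometry}`, then `Φ` is itself a
surjective linear isometry. -/
theorem isometry_group_topologically_reflexive
    {H : Type*} [NormedAddCommGroup H] [InnerProductSpace ℂ H] [CompleteSpace H]
    [TopologicalSpace.SeparableSpace H] [Nontrivial H]
    (hinf : ¬ FiniteDimensional ℂ H)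
    (Φ : lp (fun _ : ℕ => H →L[ℂ] H) ∞ →L[ℂ] lp (fun _ : ℕ => H →L[ℂ] H) ∞)
    (hloc : ∀ x : lp (fun _ : ℕ => H →L[ℂ] H) ∞,
      Φ x ∈ closure {y | ∃ Ψ : lp (fun _ : ℕ => H →L[ℂ] H) ∞ →ₗ[ℂ] lp (fun _ : ℕ => H →L[ℂ] H) ∞,
        Function.Surjective Ψ ∧ (∀ a, ‖Ψ a‖ = ‖a‖) ∧ y = Ψ x}) :
    Function.Surjective Φ ∧ ∀ a, ‖Φ a‖ = ‖a‖ := by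
  exact main_LB (H := H) hinf Φ hloc
end

section
/- Let φ : B(H) → B(H) be a Jordan homomorphism. Then the kernel of φ is either {0}, or the set of all compact operators on H, or all of B(H). -/
open scoped InnerProductSpace

namespace JordanAux

variable {H : Type*} [NormedAddCommGroup H] [InnerProductSpace ℂ H] [CompleteSpace H]

lemma jordan_lin (φ : (H →L[ℂ] H) →ₗ[ℂ] (H →L[ℂ] H))
    (hJ : ∀ A : H →L[ℂ] H, φ (A * A) = φ A * φ A) (A B : H →L[ℂ] H) :
    φ (A * B + B * A) = φ A * φ B + φ B * φ A := by
  have h := hJ (A + B)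
  have e1 : (A + B) * (A + B) = A * A + B * B + (A * B + B * A) := by noncomm_ring
  rw [e1, map_add, map_add, hJ, hJ, map_add φ A B] at h
  have e2 : (φ A + φ B) * (φ A + φ B)
      = φ A * φ A + φ B * φ B + (φ A * φ B + φ B * φ A) := by noncomm_ring
  rw [e2] at h
  exact add_left_cancel h

lemma ker_jordan (φ : (H →L[ℂ] H) →ₗ[ℂ] (H →L[ℂ] H))
    (hJ : ∀ A : H →L[ℂ] H, φ (A * A) = φ A * φ A) {A : H →L[ℂ] H} (hA : φ A = 0)
    (B : H →L[ℂ] H) : φ (B * A + A * B) = 0 := by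
  rw [jordan_lin φ hJ, hA]; simp

lemma ker_triple (φ : (H →L[ℂ] H) →ₗ[ℂ] (H →L[ℂ] H))
    (hJ : ∀ A : H →L[ℂ] H, φ (A * A) = φ A * φ A) {A : H →L[ℂ] H} (hA : φ A = 0)
    (B : H →L[ℂ] H) : φ (B * A * B) = 0 := by
  have h1 := ker_jordan φ hJ (ker_jordan φ hJ hA B) B
  have h2 := ker_jordan φ hJ hA (B * B)
  have e : B * (B * A + A * B) + (B * A + A * B) * B
      = (2 : ℂ) • (B * A * B) + (B * B * A + A * (B * B)) := by
    rw [two_smul]; noncomm_ring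
  rw [e, map_add, h2, add_zero, map_smul] at h1
  exact (smul_eq_zero.mp h1).resolve_left two_ne_zero

lemma ker_of_one (φ : (H →L[ℂ] H) →ₗ[ℂ] (H →L[ℂ] H))
    (hJ : ∀ A : H →L[ℂ] H, φ (A * A) = φ A * φ A) (h : φ 1 = 0) (A : H →L[ℂ] H) : φ A = 0 := by
  have h1 := ker_jordan φ hJ h A
  rw [mul_one, one_mul, ← two_smul ℂ, map_smul] at h1
  exact (smul_eq_zero.mp h1).resolve_left two_ne_zero

/-- the rank one operators `z ⊗ z*`. -/
noncomputable def ro (z : H) : H →L[ℂ] H := (innerSL ℂ z).smulRight z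

lemma ro_apply (z x : H) : ro z x = ⟪z, x⟫_ℂ • z := by simp [ro]

lemma ro_conj (z : H) (A : H →L[ℂ] H) : ro z * A * ro z = ⟪z, A z⟫_ℂ • ro z := by
  ext x
  simp [ro_apply, smul_smul, mul_comm]

lemma ro_mem (φ : (H →L[ℂ] H) →ₗ[ℂ] (H →L[ℂ] H))
    (hJ : ∀ A : H →L[ℂ] H, φ (A * A) = φ A * φ A) {A : H →L[ℂ] H} (hA : φ A = 0) {z : H}
    (hz : ⟪z, A z⟫_ℂ ≠ 0) : φ (ro z) = 0 := by
  have h := ker_triple φ hJ hA (ro z)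
  rw [ro_conj, map_smul] at h
  exact (smul_eq_zero.mp h).resolve_left hz

lemma ro_step (φ : (H →L[ℂ] H) →ₗ[ℂ] (H →L[ℂ] H))
    (hJ : ∀ A : H →L[ℂ] H, φ (A * A) = φ A * φ A) {x z : H} (hx : φ (ro x) = 0)
    (hz : ⟪z, x⟫_ℂ ≠ 0) : φ (ro z) = 0 := by
  apply ro_mem φ hJ hx
  rw [ro_apply, inner_smul_right]
  refine mul_ne_zero (fun h => hz ?_) hz
  rw [← inner_conj_symm, h, map_zero]

lemma ro_all (φ : (H →L[ℂ] H) →ₗ[ℂ] (H →L[ℂ] H))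
    (hJ : ∀ A : H →L[ℂ] H, φ (A * A) = φ A * φ A) {A : H →L[ℂ] H} (hA : φ A = 0)
    (hA0 : A ≠ 0) (z : H) : φ (ro z) = 0 := by
  obtain ⟨x, hx⟩ : ∃ x, ⟪x, A x⟫_ℂ ≠ 0 := by
    by_contra! h
    apply hA0
    have := (inner_map_self_eq_zero (A : H →ₗ[ℂ] H)).mp (fun x => by
      rw [← inner_conj_symm]; simp [h x])
    ext x
    simpa using congrArg (fun T : H →ₗ[ℂ] H => T x) this
  have h1 := ro_mem φ hJ hA hx
  have hx0 : x ≠ 0 := by rintro rfl; simp at hx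
  by_cases hz0 : z = 0
  · subst hz0
    have : ro (0 : H) = 0 := by ext; simp [ro_apply]
    rw [this, map_zero]
  by_cases hz : ⟪z, x⟫_ℂ = 0
  · have h2 : φ (ro (z + x)) = 0 := by
      apply ro_step φ hJ h1
      rw [inner_add_left, hz, zero_add]
      exact inner_self_ne_zero.mpr hx0
    apply ro_step φ hJ h2
    rw [inner_add_right, hz, add_zero]
    exact inner_self_ne_zero.mpr hz0
  · exact ro_step φ hJ h1 hz

variable {I : Type*}

/-- diagonal projection -/
noncomputable def dp (b : HilbertBasis I ℂ H) (s : Set I) : H →L[ℂ] H :=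
  (Submodule.span ℂ (b '' s)).topologicalClosure.starProjection

lemma dp_mem (b : HilbertBasis I ℂ H) {s : Set I} {i : I} (hi : i ∈ s) :
    dp b s (b i) = b i := by
  unfold dp
  rw [Submodule.starProjection_eq_self_iff]
  exact Submodule.le_topologicalClosure _ (Submodule.subset_span ⟨i, hi, rfl⟩)

lemma dp_not_mem (b : HilbertBasis I ℂ H) {s : Set I} {i : I} (hi : i ∉ s) :
    dp b s (b i) = 0 := by
  unfold dp
  rw [Submodule.starProjection_apply_eq_zero_iff, Submodule.orthogonal_closure,
    Submodule.mem_orthogonal]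
  intro u hu
  induction hu using Submodule.span_induction with
  | mem x hx =>
    obtain ⟨j, hj, rfl⟩ := hx
    exact b.orthonormal.2 (fun h => hi (h ▸ hj))
  | zero => simp
  | add x y _ _ hx hy => rw [inner_add_left, hx, hy, add_zero]
  | smul a x _ hx => rw [inner_smul_left, hx, mul_zero]

lemma basis_ext (b : HilbertBasis I ℂ H) {A B : H →L[ℂ] H} (h : ∀ i, A (b i) = B (b i)) :
    A = B := by
  apply ContinuousLinearMap.ext_on (s := Set.range b)
  · rw [dense_iff_closure_eq, ← Submodule.topologicalClosure_coe, b.dense_span]; rfl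
  · rintro _ ⟨i, rfl⟩; exact h i

lemma dp_mul (b : HilbertBasis I ℂ H) (s t : Set I) : dp b s * dp b t = dp b (s ∩ t) := by
  apply basis_ext b
  intro i
  rw [mul_apply_eq_comp]
  by_cases ht : i ∈ t
  · by_cases hs : i ∈ s
    · rw [dp_mem b ht, dp_mem b hs, dp_mem b (Set.mem_inter hs ht)]
    · rw [dp_mem b ht, dp_not_mem b hs, dp_not_mem b (fun h => hs h.1)]
  · rw [dp_not_mem b ht, map_zero, dp_not_mem b (fun h => ht h.2)]

lemma dp_finite (b : HilbertBasis I ℂ H) (s : Finset I) :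
    dp b (s : Set I) = ∑ i ∈ s, ro (b i) := by
  classical
  apply basis_ext b
  intro j
  have h : ∀ i, ro (b i) (b j) = if i = j then b j else 0 := by
    intro i
    rw [ro_apply, orthonormal_iff_ite.mp b.orthonormal]
    split_ifs with h <;> simp [h]
  rw [ContinuousLinearMap.sum_apply]
  simp only [h, Finset.sum_ite_eq']
  split_ifs with hj
  · exact dp_mem b hj
  · exact dp_not_mem b hj

lemma dp_compl (b : HilbertBasis I ℂ H) (s : Set I) : dp b s + dp b sᶜ = 1 := by
  apply basis_ext b
  intro i
  by_cases hs : i ∈ s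
  · have : i ∉ sᶜ := fun h => h hs
    simp [dp_mem b hs, dp_not_mem b this]
  · have : i ∈ sᶜ := hs
    simp [dp_not_mem b hs, dp_mem b this]

lemma exists_swap [Countable I] {s : Set I} (hs : s.Infinite) (hs' : sᶜ.Infinite) :
    ∃ σ : I ≃ I, (∀ i, σ (σ i) = i) ∧ ∀ i, σ i ∈ s ↔ i ∉ s := by
  classical
  have := hs.to_subtype
  have := hs'.to_subtype
  obtain ⟨e⟩ : Nonempty (s ≃ (sᶜ : Set I)) := nonempty_equiv_of_countable
  let f : I → I := fun i => if h : i ∈ s then (e ⟨i, h⟩ : I) else (e.symm ⟨i, h⟩ : I)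
  have f1 : ∀ i (h : i ∈ s), f i = e ⟨i, h⟩ := fun i h => dif_pos h
  have f2 : ∀ i (h : i ∉ s), f i = e.symm ⟨i, h⟩ := fun i h => dif_neg h
  have hf : Function.Involutive f := by
    intro i
    by_cases h : i ∈ s
    · rw [f1 i h, f2 _ (e ⟨i, h⟩).2]; simp
    · rw [f2 i h, f1 _ (e.symm ⟨i, h⟩).2]; simp
  refine ⟨hf.toPerm f, hf, fun i => ?_⟩
  change f i ∈ s ↔ _
  by_cases h : i ∈ s
  · rw [f1 i h]; exact ⟨fun h' => absurd h' (e ⟨i, h⟩).2, fun h' => absurd h h'⟩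
  · rw [f2 i h]; exact ⟨fun _ => h, fun _ => (e.symm ⟨i, h⟩).2⟩

lemma exists_perm_op (b : HilbertBasis I ℂ H) (σ : I ≃ I) :
    ∃ U : H →L[ℂ] H, ∀ i, U (b i) = b (σ i) := by
  classical
  let b' : HilbertBasis I ℂ H := HilbertBasis.mk (v := b ∘ σ)
    (b.orthonormal.comp σ σ.injective) (by
      rw [Set.range_comp, σ.range_eq_univ, Set.image_univ, b.dense_span])
  have hb' : ∀ i, b' i = b (σ i) := fun i => by
    rw [HilbertBasis.coe_mk]; rfl
  refine ⟨((b.repr.trans b'.repr.symm).toContinuousLinearEquiv : H →L[ℂ] H), fun i => ?_⟩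
  change b'.repr.symm (b.repr (b i)) = _
  rw [b.repr_self, b'.repr_symm_single, hb']

lemma dp_big [Countable I] (b : HilbertBasis I ℂ H) (φ : (H →L[ℂ] H) →ₗ[ℂ] (H →L[ℂ] H))
    (hJ : ∀ A : H →L[ℂ] H, φ (A * A) = φ A * φ A) {s : Set I} (hs : s.Infinite)
    (hs' : sᶜ.Infinite) (h : φ (dp b s) = 0) (A : H →L[ℂ] H) : φ A = 0 := by
  obtain ⟨σ, h1, h2⟩ := exists_swap hs hs'
  obtain ⟨U, hU⟩ := exists_perm_op b σ
  have e : U * dp b s * U = dp b sᶜ := by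
    apply basis_ext b
    intro i
    simp only [mul_apply_eq_comp, hU]
    by_cases hi : i ∈ s
    · rw [dp_not_mem b (fun h => (h2 i).mp h hi), dp_not_mem b (Set.notMem_compl_iff.mpr hi), map_zero]
    · rw [dp_mem b ((h2 i).mpr hi), hU, h1, dp_mem b hi]
  have h3 := ker_triple φ hJ h U
  rw [e] at h3
  apply ker_of_one φ hJ
  rw [← dp_compl b s, map_add, h, h3, add_zero]

/-- Almost disjoint family. -/
def ad (f : ℕ → Bool) : Set (List Bool) := Set.range fun n => (List.range n).map f

lemma ad_inj (f g : ℕ → Bool) {m n : ℕ} (h : (List.range n).map f = (List.range m).map g) :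
    n = m := by simpa using congrArg List.length h

lemma ad_infinite (f : ℕ → Bool) : (ad f).Infinite :=
  Set.infinite_range_of_injective fun _ _ h => ad_inj f f h

lemma ad_inter {f g : ℕ → Bool} (h : f ≠ g) : (ad f ∩ ad g).Finite := by
  obtain ⟨k, hk⟩ := Function.ne_iff.mp h
  refine ((Set.finite_Iic k).image fun n => (List.range n).map f).subset ?_
  rintro _ ⟨⟨n, rfl⟩, ⟨m, hm⟩⟩
  refine ⟨n, ?_, rfl⟩
  by_contra hn
  have hn : k < n := by simpa using hn
  have := ad_inj _ _ hm
  subst this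
  exact hk ((List.map_inj_left.mp hm k (List.mem_range.mpr hn)).symm)

lemma ad_compl (f : ℕ → Bool) : (ad f)ᶜ.Infinite := by
  have hne : f ≠ fun n => !(f n) := fun h => by
    have := congrFun h 0
    simp at this
  have := (ad_infinite (fun n => !(f n))).sdiff (ad_inter hne)
  refine this.mono ?_
  rintro x ⟨h1, h2⟩ h3
  exact h2 ⟨h3, h1⟩

lemma idem_orth {E F : H →L[ℂ] H} (hE : E * E = E) (hF : F * F = F)
    (h : E * F + F * E = 0) : E * F = 0 := by
  have h1 : E * F + E * F * E = 0 := by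
    have := congrArg (E * ·) h
    simpa [mul_add, ← mul_assoc, hE] using this
  have h2 : E * F * E + F * E = 0 := by
    have := congrArg (· * E) h
    simpa [add_mul, mul_assoc, hE] using this
  have h3 : E * F = F * E := by
    rw [eq_neg_of_add_eq_zero_left h1, eq_neg_of_add_eq_zero_right h2]
  rw [← h3, ← two_smul ℂ] at h
  exact (smul_eq_zero.mp h).resolve_left two_ne_zero

lemma countable_idem [TopologicalSpace.SeparableSpace H] {J : Type*} (E : J → H →L[ℂ] H)
    (h0 : ∀ j, E j ≠ 0) (h1 : ∀ j, E j * E j = E j) (h2 : ∀ i j, i ≠ j → E i * E j = 0) :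
    Countable J := by
  have hx : ∀ j, ∃ x, E j x = x ∧ ‖x‖ = 1 := by
    intro j
    obtain ⟨y, hy⟩ : ∃ y, E j y ≠ 0 := by
      by_contra! h
      exact h0 j (by ext y; simp [h y])
    refine ⟨((‖E j y‖⁻¹ : ℝ) : ℂ) • E j y, ?_, ?_⟩
    · rw [map_smul, ← mul_apply_eq_comp, h1]
    · rw [norm_smul]
      simp [hy]
  choose x hx hx1 using hx
  have key : ∀ i j, i ≠ j → 1 ≤ ‖E i‖ * ‖x i - x j‖ := by
    intro i j hij
    have : E i (x i - x j) = x i := by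
      rw [map_sub, hx i]
      have h3 := congrArg (fun T : H →L[ℂ] H => T (x j)) (h2 i j hij)
      simp [hx j] at h3
      rw [h3, sub_zero]
    calc 1 = ‖E i (x i - x j)‖ := by rw [this, hx1]
      _ ≤ _ := (E i).le_opNorm _
  have hb : Pairwise (Function.onFun Disjoint
      fun j => Metric.ball (x j) (2⁻¹ * (1 + ‖E j‖)⁻¹)) := by
    intro i j hij
    apply Metric.ball_disjoint_ball
    rw [dist_eq_norm]
    have a := key i j hij
    have b := key j i hij.symm
    rw [norm_sub_rev] at b
    have hi := norm_nonneg (E i)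
    have hj := norm_nonneg (E j)
    have hn := norm_nonneg (x i - x j)
    have a' : (1 + ‖E i‖)⁻¹ ≤ ‖x i - x j‖ := by
      rw [inv_le_iff_one_le_mul₀ (by positivity)]; nlinarith
    have b' : (1 + ‖E j‖)⁻¹ ≤ ‖x i - x j‖ := by
      rw [inv_le_iff_one_le_mul₀ (by positivity)]; nlinarith
    linarith
  exact hb.countable_of_isOpen_disjoint (fun _ => Metric.isOpen_ball)
    (fun j => ⟨x j, Metric.mem_ball_self (by positivity)⟩)

lemma exists_basis [TopologicalSpace.SeparableSpace H] (hinf : ¬ FiniteDimensional ℂ H) :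
    Nonempty (HilbertBasis (List Bool) ℂ H) := by
  obtain ⟨w, b, -⟩ := exists_hilbertBasis ℂ H
  have hc : Countable w := by
    refine countable_idem (fun i => ro (b i)) (fun i h => ?_) (fun i => ?_) (fun i j hij => ?_)
    · have := congrArg (fun T : H →L[ℂ] H => T (b i)) h
      simp [ro_apply, b.orthonormal.1 i] at this
      exact b.orthonormal.ne_zero i this
    · ext x
      simp [ro_apply, b.orthonormal.1 i]
    · ext x
      simp [ro_apply, b.orthonormal.2 hij]
  have hi : Infinite w := by
    by_contra hfin
    rw [not_infinite_iff_finite] at hfin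
    have := Fintype.ofFinite w
    exact hinf (b.toOrthonormalBasis.toBasis.finiteDimensional_of_finite)
  obtain ⟨e⟩ : Nonempty (List Bool ≃ w) := nonempty_equiv_of_countable
  exact ⟨HilbertBasis.mk (v := b ∘ e) (b.orthonormal.comp e e.injective) (by
      rw [Set.range_comp, e.range_eq_univ, Set.image_univ, b.dense_span])⟩

end JordanAux

/-- Let `H` be a complex separable infinite-dimensional Hilbert space and
let `φ : B(H) → B(H)` be a Jordan homomorphism. Then the kernel of `φ` is either `{0}`,
or the set of all compact operators on `H`, or all of `B(H)`. -/
theorem jordan_hom_kernel_trichotomy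
    {H : Type*} [NormedAddCommGroup H] [InnerProductSpace ℂ H] [CompleteSpace H]
    [TopologicalSpace.SeparableSpace H] (hinf : ¬ FiniteDimensional ℂ H)
    (φ : (H →L[ℂ] H) →ₗ[ℂ] (H →L[ℂ] H))
    (hJ : ∀ A : H →L[ℂ] H, φ (A * A) = φ A * φ A) :
    {A : H →L[ℂ] H | φ A = 0} = {0} ∨
    {A : H →L[ℂ] H | φ A = 0} = {A : H →L[ℂ] H | IsCompactOperator A} ∨
    {A : H →L[ℂ] H | φ A = 0} = Set.univ := by
  by_cases hker : ∀ A, φ A = 0 → A = 0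
  · left
    ext A
    exact ⟨fun h => hker A h, fun h => by rw [Set.mem_singleton_iff] at h; simp [h]⟩
  right; right
  push Not at hker
  obtain ⟨A, hA, hA0⟩ := hker
  have hro := JordanAux.ro_all φ hJ hA hA0
  obtain ⟨b⟩ := JordanAux.exists_basis hinf
  obtain ⟨f, hf⟩ : ∃ f : ℕ → Bool, φ (JordanAux.dp b (JordanAux.ad f)) = 0 := by
    by_contra! hne
    have hid : ∀ f, φ (JordanAux.dp b (JordanAux.ad f)) * φ (JordanAux.dp b (JordanAux.ad f))
        = φ (JordanAux.dp b (JordanAux.ad f)) := fun f => by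
      rw [← hJ, JordanAux.dp_mul, Set.inter_self]
    have hcount : Countable (ℕ → Bool) := by
      refine JordanAux.countable_idem (fun f => φ (JordanAux.dp b (JordanAux.ad f))) hne hid ?_
      intro f g hfg
      apply JordanAux.idem_orth (hid f) (hid g)
      have h0 : φ (JordanAux.dp b (JordanAux.ad f ∩ JordanAux.ad g)) = 0 := by
        obtain ⟨s, hs⟩ := (JordanAux.ad_inter hfg).exists_finset_coe
        rw [← hs, JordanAux.dp_finite, map_sum]
        exact Finset.sum_eq_zero fun i _ => hro (b i)
      rw [← JordanAux.jordan_lin φ hJ, JordanAux.dp_mul, JordanAux.dp_mul,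
        Set.inter_comm (JordanAux.ad g), map_add, h0, add_zero]
    obtain ⟨F, hF⟩ := exists_injective_nat (ℕ → Bool)
    exact Function.cantor_injective (fun s : Set ℕ => F (fun n => by classical exact decide (n ∈ s)))
      (fun s t h => by
        have := hF h
        ext n
        simpa using congrFun this n)
  ext B
  simpa using JordanAux.dp_big b φ hJ (JordanAux.ad_infinite f) (JordanAux.ad_compl f) hf B
end
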